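/- arXiv:2405.10617 — 5 statements merged into one kernel-verified Lean document; each statement's English description precedes it below -/
import Mathlib

section
/- Let (W,S) be a Coxeter system of finite rank n ≥ 3 whose Coxeter diagram is the complete graph (i.e. m_{st} ≥ 3 for all s ≠ t ∈ S). Then the growth function of (W,S) diverges at 1/(n-2); that is, the sequence i ↦ (c_i : ℝ)/(n-2)^i is not summable. -/
namespace CoxGrowth
open CoxeterSystem
variable {B : Type*} {W : Type*} [Group W] {M : CoxeterMatrix B} (cs : CoxeterSystem M W)

open Classical in
/-- The action of a simple reflection on `W × ZMod 2`. -/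
noncomputable def act (i : B) : Function.End (W × ZMod 2) :=
  fun p => (cs.simple i * p.1 * cs.simple i, p.2 + if p.1 = cs.simple i then 1 else 0)

open Classical in
lemma act_pow (i j : B) (k : ℕ) (t : W) (e : ZMod 2) :
    ((act cs i * act cs j) ^ k) (t, e) =
      ((cs.simple i * cs.simple j) ^ k * t * ((cs.simple i * cs.simple j) ^ k)⁻¹,
        e + ∑ l ∈ Finset.range (2 * k),
          if t = cs.simple j * (cs.simple i * cs.simple j) ^ l then 1 else 0) := by
  induction k with
  | zero => simp; rfl
  | succ k ih =>
    have hconj : ∀ k : ℕ, (cs.simple i * cs.simple j) ^ k * cs.simple j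
        = cs.simple j * ((cs.simple i * cs.simple j) ^ k)⁻¹ := by
      intro k
      induction k with
      | zero => simp
      | succ k ih =>
        rw [pow_succ', mul_assoc, ih, ← pow_succ', pow_succ]
        simp [mul_assoc]
    rw [pow_succ']
    change (act cs i * act cs j) (((act cs i * act cs j) ^ k) (t, e)) = _
    rw [ih]
    change act cs i (act cs j _) = _
    have hx : cs.simple j * cs.simple i * cs.simple j =
      cs.simple j * (cs.simple i * cs.simple j) := mul_assoc _ _ _
    have h1 : ((cs.simple i * cs.simple j) ^ k * t * ((cs.simple i * cs.simple j) ^ k)⁻¹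
        = cs.simple j) ↔ t = cs.simple j * (cs.simple i * cs.simple j) ^ (2 * k) := by
      rw [mul_inv_eq_iff_eq_mul]
      constructor
      · intro h
        have : t = ((cs.simple i * cs.simple j) ^ k)⁻¹ * (cs.simple j *
          (cs.simple i * cs.simple j) ^ k) := by rw [← h]; group
        rw [this, two_mul, pow_add, ← mul_assoc, ← mul_assoc]
        congr 1
        rw [inv_mul_eq_iff_eq_mul, ← mul_assoc, hconj]; simp
      · rintro rfl
        rw [← mul_assoc, hconj, two_mul, pow_add]; group
    have h2 : (cs.simple j * ((cs.simple i * cs.simple j) ^ k * t *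
        ((cs.simple i * cs.simple j) ^ k)⁻¹) * cs.simple j
        = cs.simple i) ↔ t = cs.simple j * (cs.simple i * cs.simple j) ^ (2 * k + 1) := by
      have : (cs.simple j * ((cs.simple i * cs.simple j) ^ k * t *
        ((cs.simple i * cs.simple j) ^ k)⁻¹) * cs.simple j
        = cs.simple i) ↔ (cs.simple i * cs.simple j) ^ k * t = 
          cs.simple j * (cs.simple i * cs.simple j) ^ (k + 1) := by
        rw [pow_succ']
        generalize (cs.simple i * cs.simple j) ^ k = y
        constructor
        · intro h
          rw [← h]; simp [mul_assoc]
        · intro h; rw [h]; simp [mul_assoc]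
      rw [this]
      have e2 : (2 * k + 1) = k + (k + 1) := by ring
      rw [e2, pow_add _ k (k+1), ← mul_assoc]
      constructor
      · intro h
        rw [← mul_right_inj ((cs.simple i * cs.simple j) ^ k), h, ← mul_assoc, ← mul_assoc, hconj]
        simp
      · rintro rfl
        rw [← mul_assoc, ← mul_assoc, hconj]; simp
    simp only [act]
    ext1
    · simp [pow_succ', mul_assoc]
    · simp only [h1, h2]
      rw [show 2 * (k + 1) = 2 * k + 1 + 1 by ring, Finset.sum_range_succ, Finset.sum_range_succ]
      ring

lemma act_liftable : M.IsLiftable (act cs) := by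
  classical
  intro i j
  funext ⟨t, e⟩
  rw [act_pow, cs.simple_mul_simple_pow]
  change _ = (t, e)
  have : ∑ l ∈ Finset.range (2 * M i j),
      (if t = cs.simple j * (cs.simple i * cs.simple j) ^ l then (1 : ZMod 2) else 0) = 0 := by
    rw [two_mul, Finset.sum_range_add]
    simp only [pow_add, cs.simple_mul_simple_pow, one_mul]
    exact CharTwo.add_self_eq_zero _
  rw [this]; simp

open Classical in
lemma lift_word (ω : List B) (t : W) (e : ZMod 2) :
    cs.lift ⟨act cs, act_liftable cs⟩ (cs.wordProd ω) (t, e) =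
      (cs.wordProd ω * t * (cs.wordProd ω)⁻¹, e + ((cs.rightInvSeq ω).count t : ℕ)) := by
  induction ω with
  | nil => simp; rfl
  | cons i ω ih =>
    rw [cs.wordProd_cons, map_mul]
    change cs.lift ⟨act cs, act_liftable cs⟩ (cs.simple i)
      (cs.lift ⟨act cs, act_liftable cs⟩ (cs.wordProd ω) (t, e)) = _
    rw [ih, cs.lift_apply_simple]
    simp only [act, rightInvSeq, List.count_cons]
    ext1
    · simp [mul_assoc]
    · have : (cs.wordProd ω * t * (cs.wordProd ω)⁻¹ = cs.simple i) ↔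
        ((cs.wordProd ω)⁻¹ * cs.simple i * cs.wordProd ω = t) := by
        constructor
        · intro h; rw [← h]; group
        · intro h; rw [← h]; group
      simp only [this, beq_iff_eq]
      push_cast
      ring

lemma exchange (ω : List B) (i : B) (h : cs.IsRightDescent (cs.wordProd ω) i) :
    ∃ j < ω.length, cs.wordProd ω * cs.simple i = cs.wordProd (ω.eraseIdx j) := by
  classical
  obtain ⟨ω', h1, h2⟩ := cs.exists_isReduced (cs.wordProd ω * cs.simple i)
  have h3 : cs.wordProd ω = cs.wordProd (ω' ++ [i]) := by
    rw [cs.wordProd_append, ← h2]; simp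
  have hr : cs.IsReduced (ω' ++ [i]) := by
    unfold CoxeterSystem.IsReduced at h1 ⊢
    rw [← h3]
    have := cs.isRightDescent_iff.1 h
    rw [h2] at this
    simp; omega
  have hmem : cs.simple i ∈ cs.rightInvSeq (ω' ++ [i]) := by
    rw [← List.concat_eq_append, cs.rightInvSeq_concat]; simp
  have hc := List.count_eq_one_of_mem hr.nodup_rightInvSeq hmem
  have e1 := lift_word cs ω (cs.simple i) 0
  have e2 := lift_word cs (ω' ++ [i]) (cs.simple i) 0
  rw [← h3, e1] at e2
  have e3 := congrArg Prod.snd e2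
  simp only [hc] at e3
  have hm : cs.simple i ∈ cs.rightInvSeq ω := by
    by_contra hn
    rw [List.count_eq_zero_of_not_mem hn] at e3
    simp at e3
  obtain ⟨j, hj, hj'⟩ := List.getElem_of_mem hm
  refine ⟨j, by simpa using hj, ?_⟩
  rw [← cs.wordProd_mul_getD_rightInvSeq, List.getD_eq_getElem _ _ hj, hj']

lemma desc_step1 {w : W} {s t : B} (hst : cs.simple s ≠ cs.simple t)
    (hs : cs.IsRightDescent w s) (ht : cs.IsRightDescent w t) :
    cs.IsRightDescent (w * cs.simple t) s := by
  obtain ⟨ω, h1, h2⟩ := cs.exists_isReduced (w * cs.simple s)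
  have hw : w = cs.wordProd (ω ++ [s]) := by
    rw [cs.wordProd_append, ← h2]; simp
  have ls := cs.isRightDescent_iff.1 hs
  have lt := cs.isRightDescent_iff.1 ht
  have hl : cs.length (w * cs.simple s) = ω.length := by rw [h2]; exact h1
  obtain ⟨j, hj, he⟩ := exchange cs (ω ++ [s]) t (hw ▸ ht)
  rw [← hw] at he
  rcases Nat.lt_or_ge j ω.length with hlt | hge
  · rw [List.eraseIdx_append_of_lt_length hlt, cs.wordProd_append] at he
    have := cs.length_wordProd_le (ω.eraseIdx j)
    rw [List.length_eraseIdx_of_lt hlt] at this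
    have e2 : w * cs.simple t * cs.simple s = cs.wordProd (ω.eraseIdx j) := by
      rw [he]; simp
    unfold IsRightDescent
    rw [e2]
    omega
  · rw [List.eraseIdx_append_of_length_le hge] at he
    have : j = ω.length := by simp at hj; omega
    subst this
    simp at he
    rw [← h2] at he
    exact absurd (mul_left_cancel he).symm hst

lemma desc_step2 {w : W} {s t : B} (hst : cs.simple s ≠ cs.simple t)
    (hc : cs.simple s * cs.simple t ≠ cs.simple t * cs.simple s)
    (hs : cs.IsRightDescent w s) (ht : cs.IsRightDescent w t) :
    cs.IsRightDescent (w * cs.simple s * cs.simple t) s := by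
  have h3 := cs.isRightDescent_iff.1 (desc_step1 cs hst hs ht)
  have h4 := cs.isRightDescent_iff.1 (desc_step1 cs hst.symm ht hs)
  have ls := cs.isRightDescent_iff.1 hs
  have lt := cs.isRightDescent_iff.1 ht
  obtain ⟨ω, h1, h2⟩ := cs.exists_isReduced (w * cs.simple t * cs.simple s)
  have hw : w = cs.wordProd (ω ++ [s, t]) := by
    rw [cs.wordProd_append, ← h2]; simp [wordProd_cons, ← mul_assoc]
  have hl : cs.length (w * cs.simple t * cs.simple s) = ω.length := by rw [h2]; exact h1
  obtain ⟨j, hj, he⟩ := exchange cs (ω ++ [s, t]) s (hw ▸ hs)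
  rw [← hw] at he
  rcases Nat.lt_or_ge j ω.length with hlt | hge
  · rw [List.eraseIdx_append_of_lt_length hlt, cs.wordProd_append] at he
    have := cs.length_wordProd_le (ω.eraseIdx j)
    rw [List.length_eraseIdx_of_lt hlt] at this
    have e2 : w * cs.simple s * cs.simple t * cs.simple s = cs.wordProd (ω.eraseIdx j) := by
      rw [he]; simp [wordProd_cons, ← mul_assoc]
    unfold IsRightDescent
    rw [e2]
    omega
  · exfalso
    rw [List.eraseIdx_append_of_length_le hge] at he
    have : j = ω.length ∨ j = ω.length + 1 := by simp at hj; omega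
    rcases this with rfl | rfl
    · simp [wordProd_append, ← h2] at he
      simp only [mul_assoc] at he
      have := mul_left_cancel he
      apply hc
      have h5 : cs.simple s = cs.simple t * (cs.simple s * cs.simple t) := this
      nth_rw 1 [h5]
      simp [mul_assoc]
    · simp [wordProd_append, ← h2] at he
      exact hst he

lemma no_cycle (hne : ∀ s t : B, s ≠ t → cs.simple s ≠ cs.simple t)
    (hc : ∀ s t : B, s ≠ t → cs.simple s * cs.simple t ≠ cs.simple t * cs.simple s) (N : ℕ) :
    ∀ (w : W) (t r s : B), cs.length w = N → t ≠ r → r ≠ s → s ≠ t →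
      cs.IsRightDescent w t → cs.IsRightDescent w r → cs.IsRightDescent (w * cs.simple t) r →
      cs.IsRightDescent (w * cs.simple t) s → False := by
  induction N using Nat.strong_induction_on with
  | _ N ih =>
    intro w t r s hN htr hrs hst h1 h2 h3 h4
    refine ih _ ?_ (w * cs.simple t) r s t rfl hrs hst htr h3 h4 ?_ ?_
    · rw [← hN]; exact h1
    · exact desc_step1 cs (hne _ _ hrs.symm) h4 h3
    · exact desc_step2 cs (hne _ _ htr) (hc _ _ htr) h1 h2

open Classical in
/-- The right descent set. -/
noncomputable def D [Fintype B] (w : W) : Finset B :=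
  Finset.univ.filter (fun s => cs.IsRightDescent w s)

lemma mem_D [Fintype B] {w : W} {s : B} : s ∈ D cs w ↔ cs.IsRightDescent w s := by
  simp [D]

lemma card_D_le [Fintype B] (hne : ∀ s t : B, s ≠ t → cs.simple s ≠ cs.simple t)
    (hc : ∀ s t : B, s ≠ t → cs.simple s * cs.simple t ≠ cs.simple t * cs.simple s) (w : W) :
    (D cs w).card ≤ 2 := by
  by_contra! h
  obtain ⟨r, s, t, hr, hs, ht, h1, h2, h3⟩ := Finset.two_lt_card_iff.1 h
  rw [mem_D] at hr hs ht
  exact no_cycle cs hne hc _ w t r s rfl h2.symm h1 h3 ht hr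
    (desc_step1 cs (hne _ _ h2) hr ht) (desc_step1 cs (hne _ _ h3) hs ht)

open Classical in
/-- Ascents leading to an element with at least two descents. -/
noncomputable def bad [Fintype B] (w : W) : Finset B :=
  (D cs w)ᶜ.filter (fun s => 2 ≤ (D cs (w * cs.simple s)).card)

lemma bad_bound [Fintype B] (hne : ∀ s t : B, s ≠ t → cs.simple s ≠ cs.simple t)
    (hc : ∀ s t : B, s ≠ t → cs.simple s * cs.simple t ≠ cs.simple t * cs.simple s) (w : W) :
    2 * (D cs w).card + (bad cs w).card ≤ 4 := by
  classical
  have h2 := card_D_le cs hne hc w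
  have key : ∀ s ∈ bad cs w, ∃ t, D cs w = {t} ∧ s ∈ D cs (w * cs.simple t) := by
    intro s hs
    simp only [bad, Finset.mem_filter, Finset.mem_compl] at hs
    obtain ⟨hs1, hs2⟩ := hs
    have hsd : s ∈ D cs (w * cs.simple s) := by
      rw [mem_D] at hs1 ⊢
      rw [cs.isRightDescent_iff_not_isRightDescent_mul]
      simpa using hs1
    obtain ⟨t, ht, hts⟩ := Finset.exists_mem_ne (s := D cs (w * cs.simple s)) (by omega) s
    rw [mem_D] at hsd ht hs1
    have h1 := desc_step1 cs (hne _ _ hts) ht hsd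
    have h2 := desc_step2 cs (hne _ _ hts.symm) (hc _ _ hts.symm) hsd ht
    rw [cs.simple_mul_simple_cancel_right] at h1 h2
    refine ⟨t, ?_, (mem_D cs).2 h2⟩
    ext u
    rw [mem_D, Finset.mem_singleton]
    constructor
    · intro hu
      by_contra hut
      have hus : u ≠ s := by rintro rfl; exact hs1 hu
      refine no_cycle cs hne hc _ (w * cs.simple s) s t u rfl hts.symm (Ne.symm hut) hus hsd ht ?_ ?_
      · rwa [cs.simple_mul_simple_cancel_right]
      · rwa [cs.simple_mul_simple_cancel_right]
    · rintro rfl; exact h1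
  rcases (bad cs w).eq_empty_or_nonempty with h | ⟨s, hs⟩
  · rw [h]; simp; omega
  · obtain ⟨t, ht, -⟩ := key s hs
    have hsub : bad cs w ⊆ D cs (w * cs.simple t) := by
      intro r hr
      obtain ⟨t', ht', hr'⟩ := key r hr
      rw [ht] at ht'
      rwa [Finset.singleton_injective ht']
    have h3 := Finset.card_le_card hsub
    have h4 := card_D_le cs hne hc (w * cs.simple t)
    rw [ht]
    simp
    omega

lemma finite_level [Fintype B] (i : ℕ) : {w : W | cs.length w = i}.Finite := by
  refine ((List.finite_length_eq B i).image cs.wordProd).subset ?_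
  intro w hw
  obtain ⟨ω, h1, h2⟩ := cs.exists_isReduced w
  refine ⟨ω, ?_, h2.symm⟩
  change ω.length = i
  rw [← h1, ← h2]
  exact hw

/-- The finite set of elements of length `i`. -/
noncomputable def L [Fintype B] (i : ℕ) : Finset W := (finite_level cs i).toFinset

lemma mem_L [Fintype B] {i : ℕ} {w : W} : w ∈ L cs i ↔ cs.length w = i := by
  simp [L]

lemma card_step [Fintype B] (hne : ∀ s t : B, s ≠ t → cs.simple s ≠ cs.simple t)
    (hc : ∀ s t : B, s ≠ t → cs.simple s * cs.simple t ≠ cs.simple t * cs.simple s) (i : ℕ) :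
    (Fintype.card B - 2) * (L cs i).card ≤ (L cs (i + 1)).card := by
  classical
  let g : W → ℕ := fun w => if 2 ≤ (D cs w).card then 1 else 2
  have h1 : ∑ w ∈ L cs i, ∑ s ∈ (D cs w)ᶜ, g (w * cs.simple s)
      = ∑ w ∈ L cs (i + 1), ∑ s ∈ D cs w, g w := by
    rw [Finset.sum_sigma', Finset.sum_sigma']
    refine Finset.sum_bij' (fun p _ => ⟨p.1 * cs.simple p.2, p.2⟩)
      (fun p _ => ⟨p.1 * cs.simple p.2, p.2⟩) ?_ ?_ ?_ ?_ ?_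
    · rintro ⟨w, s⟩ h
      simp only [Finset.mem_sigma, Finset.mem_compl, mem_L, mem_D] at h ⊢
      have := cs.not_isRightDescent_iff.1 h.2
      refine ⟨by omega, ?_⟩
      rw [cs.isRightDescent_iff_not_isRightDescent_mul, cs.simple_mul_simple_cancel_right]
      exact h.2
    · rintro ⟨w, s⟩ h
      simp only [Finset.mem_sigma, Finset.mem_compl, mem_L, mem_D] at h ⊢
      have := cs.isRightDescent_iff.1 h.2
      exact ⟨by omega, cs.isRightDescent_iff_not_isRightDescent_mul.1 h.2⟩
    · rintro ⟨w, s⟩ h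
      simp
    · rintro ⟨w, s⟩ h
      simp
    · rintro ⟨w, s⟩ h
      rfl
  have h2 : ∑ w ∈ L cs (i + 1), ∑ s ∈ D cs w, g w ≤ ∑ w ∈ L cs (i + 1), 2 := by
    refine Finset.sum_le_sum fun w _ => ?_
    have := card_D_le cs hne hc w
    simp only [Finset.sum_const, smul_eq_mul, g]
    split_ifs <;> omega
  have h3 : ∑ w ∈ L cs i, 2 * (Fintype.card B - 2) ≤
      ∑ w ∈ L cs i, ∑ s ∈ (D cs w)ᶜ, g (w * cs.simple s) := by
    refine Finset.sum_le_sum fun w _ => ?_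
    have hb := bad_bound cs hne hc w
    have e1 : ∑ s ∈ (D cs w)ᶜ, g (w * cs.simple s) + (bad cs w).card
        = ∑ s ∈ (D cs w)ᶜ, 2 := by
      rw [bad, Finset.card_filter, ← Finset.sum_add_distrib]
      refine Finset.sum_congr rfl fun s _ => ?_
      simp only [g]
      split_ifs <;> rfl
    rw [Finset.sum_const, smul_eq_mul, Finset.card_compl] at e1
    omega
  simp only [Finset.sum_const, smul_eq_mul] at h1 h2 h3
  nlinarith

lemma card_pow [Fintype B] (hne : ∀ s t : B, s ≠ t → cs.simple s ≠ cs.simple t)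
    (hc : ∀ s t : B, s ≠ t → cs.simple s * cs.simple t ≠ cs.simple t * cs.simple s) (i : ℕ) :
    (Fintype.card B - 2) ^ i ≤ (L cs i).card := by
  induction i with
  | zero =>
    rw [pow_zero, Nat.one_le_iff_ne_zero, Finset.card_ne_zero]
    exact ⟨1, by rw [mem_L]; simp⟩
  | succ i ih =>
    rw [pow_succ']
    exact (Nat.mul_le_mul_left _ ih).trans (card_step cs hne hc i)

end CoxGrowth


/-- **Theorem C.** Let `(W, S)` be a Coxeter system of finite rank `n ≥ 3` whose Coxeter
diagram is the complete graph, i.e. for all `s ≠ t` in `S` the order `m s t` of `s * t` is at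
least `3` (possibly infinite; `orderOf = 0` encodes infinite order). Then the growth series
of `(W, S)` diverges at `1 / (n - 2)`, i.e. `i ↦ c i / (n - 2) ^ i` is not summable, where
`c i` is the number of elements of `W` of length `i`. -/
theorem growth_not_summable_of_complete_graph_rank_ge_three
    {B : Type*} [Fintype B] {W : Type*} [Group W] {M : CoxeterMatrix B}
    (cs : CoxeterSystem M W) (n : ℕ) (hn : Fintype.card B = n) (hn3 : 3 ≤ n)
    (hcomp : ∀ s t : B, s ≠ t →
      orderOf (cs.simple s * cs.simple t) = 0 ∨ 3 ≤ orderOf (cs.simple s * cs.simple t)) :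
    ¬ Summable (fun i : ℕ =>
      (Nat.card {w : W // cs.length w = i} : ℝ) / ((n : ℝ) - 2) ^ i) := by
  have hne : ∀ s t : B, s ≠ t → cs.simple s ≠ cs.simple t := by
    intro s t hst h
    have := hcomp s t hst
    rw [h, cs.simple_mul_simple_self, orderOf_one] at this
    omega
  have hc : ∀ s t : B, s ≠ t → cs.simple s * cs.simple t ≠ cs.simple t * cs.simple s := by
    intro s t hst h
    have h1 : (cs.simple s * cs.simple t) ^ 2 = 1 := by
      rw [pow_two]
      nth_rw 1 [h]
      simp [mul_assoc]
    have h2 := orderOf_dvd_of_pow_eq_one h1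
    have h3 := Nat.le_of_dvd (by norm_num) h2
    rcases hcomp s t hst with h4 | h4
    · rw [h4] at h2; simp at h2
    · omega
  intro hsum
  have hlim := hsum.tendsto_atTop_zero
  have hge : ∀ i : ℕ, (1 : ℝ) ≤
      (Nat.card {w : W // cs.length w = i} : ℝ) / ((n : ℝ) - 2) ^ i := by
    intro i
    have hpos : (0 : ℝ) < (n : ℝ) - 2 := by
      have : (3 : ℝ) ≤ n := by exact_mod_cast hn3
      linarith
    rw [le_div_iff₀ (pow_pos hpos i), one_mul]
    have h1 := CoxGrowth.card_pow cs hne hc i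
    have h2 : Nat.card {w : W // cs.length w = i} = (CoxGrowth.L cs i).card :=
      Nat.subtype_card _ (fun w => CoxGrowth.mem_L cs)
    rw [h2]
    rw [hn] at h1
    have h3 : ((n : ℝ) - 2) = ((n - 2 : ℕ) : ℝ) := by
      rw [Nat.cast_sub (by omega)]; norm_num
    rw [h3]
    exact_mod_cast h1
  have := ge_of_tendsto' hlim hge
  norm_num at this
end

section
/- Let (W,S) be a 2-spherical Coxeter system of finite rank n ≥ 3 whose Coxeter diagram is the complete graph. Then for every w ∈ W, the set of right descents {s ∈ S : ℓ(ws) < ℓ(w)} has at most two elements. -/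
namespace CoxDesc

open CoxeterSystem List

variable {B : Type*} {W : Type*} [Group W] {M : CoxeterMatrix B} (cs : CoxeterSystem M W)

lemma alt_two_succ (i j : B) (k : ℕ) :
    alternatingWord i j (2 * (k + 1)) = i :: j :: alternatingWord i j (2 * k) := by
  rw [show 2 * (k + 1) = 2 * k + 1 + 1 by ring, alternatingWord_succ', alternatingWord_succ']
  simp

lemma alt_reverse (i j : B) (k : ℕ) :
    (alternatingWord i j (2 * k)).reverse = alternatingWord j i (2 * k) := by
  induction k with
  | zero => simp [alternatingWord]
  | succ k ih =>
    rw [alt_two_succ j i, show 2 * (k + 1) = 2 * k + 1 + 1 by ring, alternatingWord_succ,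
      alternatingWord_succ, ← ih]
    simp

lemma lis_alt (i j : B) (m : ℕ) :
    cs.leftInvSeq (alternatingWord j i (2 * m)) =
      (List.range (2 * m)).map (fun k => cs.simple j * (cs.simple i * cs.simple j) ^ k) := by
  apply List.ext_getElem
  · simp
  · intro k h1 h2
    rw [cs.getElem_leftInvSeq_alternatingWord j i m k (by simpa using h1),
      prod_alternatingWord_eq_mul_pow]
    have h3 : (2 * k + 1) / 2 = k := by omega
    simp [h3]

open scoped Classical in
lemma count_even (i j : B) (t : W) :
    (((cs.rightInvSeq (alternatingWord i j (2 * M i j))).count t : ℕ) : ZMod 2) = 0 := by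
  rw [← alt_reverse, rightInvSeq_reverse, List.count_reverse, lis_alt, two_mul, List.range_add,
    List.map_append, List.map_map, List.count_append]
  have : ((fun k => cs.simple j * (cs.simple i * cs.simple j) ^ k) ∘ fun x => M i j + x)
      = (fun k => cs.simple j * (cs.simple i * cs.simple j) ^ k) := by
    funext k
    simp [pow_add]
  rw [this]
  push_cast
  exact CharTwo.add_self_eq_zero _

open scoped Classical in
/-- The generator of the action on `W × ZMod 2`. -/
noncomputable def act (i : B) : Function.End (W × ZMod 2) :=
  fun p => (cs.simple i * p.1 * cs.simple i, p.2 + if p.1 = cs.simple i then 1 else 0)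

open scoped Classical in
lemma act_word (ω : List B) (t : W) (e : ZMod 2) :
    (ω.map (act cs)).prod (t, e) =
      (cs.wordProd ω * t * (cs.wordProd ω)⁻¹, e + ((cs.rightInvSeq ω).count t : ℕ)) := by
  induction ω with
  | nil =>
    have h : (1 : Function.End (W × ZMod 2)) (t, e) = (t, e) := rfl
    simpa using h
  | cons i ω ih =>
    rw [List.map_cons, List.prod_cons]
    change act cs i ((ω.map (act cs)).prod (t, e)) = _
    rw [ih]
    have hiff : cs.wordProd ω * t * (cs.wordProd ω)⁻¹ = cs.simple i ↔
        (cs.wordProd ω)⁻¹ * cs.simple i * cs.wordProd ω = t := by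
      constructor
      · intro h; rw [← h]; group
      · intro h; rw [← h]; group
    simp only [act, rightInvSeq, wordProd_cons, List.count_cons, mul_inv_rev, inv_simple, hiff,
      beq_iff_eq, Prod.mk.injEq]
    refine ⟨by simp only [mul_assoc], ?_⟩
    push_cast
    ring

lemma act_pow (i j : B) (m : ℕ) :
    (act cs i * act cs j) ^ m = ((alternatingWord i j (2 * m)).map (act cs)).prod := by
  induction m with
  | zero => simp [alternatingWord]
  | succ k ih => rw [pow_succ', alt_two_succ, ih]; simp [mul_assoc]

lemma act_liftable : M.IsLiftable (act cs) := by
  classical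
  intro i j
  rw [act_pow]
  funext ⟨t, e⟩
  rw [act_word, count_even, prod_alternatingWord_eq_mul_pow]
  have h : (t, e) = (1 : Function.End (W × ZMod 2)) (t, e) := rfl
  simpa using h

open scoped Classical in
lemma count_congr {ω ω' : List B} (h : cs.wordProd ω = cs.wordProd ω') (t : W) :
    (((cs.rightInvSeq ω).count t : ℕ) : ZMod 2) = ((cs.rightInvSeq ω').count t : ℕ) := by
  have key : ∀ ω : List B, cs.lift ⟨act cs, act_liftable cs⟩ (cs.wordProd ω)
      = (ω.map (act cs)).prod := by
    intro ω
    rw [wordProd, map_list_prod, List.map_map]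
    congr 1
    apply List.map_congr_left
    intro i _
    simp
  have h1 : (ω.map (act cs)).prod (t, 0) = (ω'.map (act cs)).prod (t, 0) := by
    rw [← key, ← key, h]
  rw [act_word, act_word] at h1
  simpa using congrArg Prod.snd h1

/-- The exchange condition. -/
lemma exchange (ω : List B) (i : B)
    (h : cs.length (cs.wordProd ω * cs.simple i) < cs.length (cs.wordProd ω)) :
    cs.simple i ∈ cs.rightInvSeq ω := by
  classical
  obtain ⟨ν, hν, hν'⟩ := cs.exists_isReduced (cs.wordProd ω * cs.simple i)
  have hprod : cs.wordProd (ν.concat i) = cs.wordProd ω := by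
    rw [wordProd_concat, ← hν']; simp
  have hred : cs.IsReduced (ν.concat i) := by
    have := (cs.isRightDescent_iff (w := cs.wordProd ω) (i := i)).1 h
    rw [CoxeterSystem.IsReduced, hprod, ← this, hν', hν.eq]
    simp
  have hmem : cs.simple i ∈ cs.rightInvSeq (ν.concat i) := by
    rw [rightInvSeq_concat]; simp
  have hc := List.count_eq_one_of_mem hred.nodup_rightInvSeq hmem
  have := count_congr cs hprod (cs.simple i)
  rw [hc] at this
  by_contra hn
  rw [List.count_eq_zero_of_not_mem hn] at this
  simp at this

lemma ris_append (ω ν : List B) :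
    cs.rightInvSeq (ω ++ ν) =
      (cs.rightInvSeq ω).map (fun t => (cs.wordProd ν)⁻¹ * t * cs.wordProd ν)
        ++ cs.rightInvSeq ν := by
  induction ω with
  | nil => simp
  | cons i ω ih => simp [rightInvSeq, ih, wordProd_append, mul_assoc]

/-- Words in the letters `a`, `b`. -/
def Two (a b : B) (ω : List B) : Prop := ∀ i ∈ ω, i = a ∨ i = b

/-- `u` is shortest in its coset. -/
def Minl (a b : B) (u : W) : Prop :=
  ∀ ω, Two a b ω → cs.length u ≤ cs.length (u * cs.wordProd ω)

lemma mem_ris_of_descent {a b : B} {u : W} (hu : Minl cs a b u) {ω : List B} (hω : Two a b ω)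
    {i : B} (hi : i = a ∨ i = b)
    (h : cs.length (u * cs.wordProd ω * cs.simple i) < cs.length (u * cs.wordProd ω)) :
    cs.simple i ∈ cs.rightInvSeq ω := by
  obtain ⟨ν, hν, rfl⟩ := cs.exists_isReduced u
  rw [← wordProd_append] at h
  have := exchange cs _ i h
  rw [ris_append, List.mem_append, List.mem_map] at this
  rcases this with ⟨r, hr, hri⟩ | h
  · exfalso
    have h1 := (cs.isRightInversion_of_mem_rightInvSeq hν hr).2
    have h2 : r = cs.wordProd (ω ++ [i] ++ ω.reverse) := by
      simp only [wordProd_append, wordProd_reverse, wordProd_singleton, ← hri]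
      group
    have h3 := hu (ω ++ [i] ++ ω.reverse) (by
      intro k hk
      simp only [List.mem_append, List.mem_reverse, List.mem_singleton] at hk
      rcases hk with (hk | rfl) | hk
      · exact hω k hk
      · exact hi
      · exact hω k hk)
    rw [← h2] at h3
    omega
  · exact h

lemma exists_decomp (a b : B) (x : W) :
    ∃ u, Minl cs a b u ∧ ∃ ω, Two a b ω ∧ x = u * cs.wordProd ω := by
  classical
  have hex : ∃ n, ∃ ω, Two a b ω ∧ cs.length (x * cs.wordProd ω) = n :=
    ⟨_, [], by simp [Two], rfl⟩
  obtain ⟨ω, hω, hl⟩ := Nat.find_spec hex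
  refine ⟨x * cs.wordProd ω, ?_, ω.reverse, ?_, ?_⟩
  · intro ν hν
    rw [hl]
    apply Nat.find_min' hex
    refine ⟨ω ++ ν, ?_, ?_⟩
    · intro k hk
      rcases List.mem_append.1 hk with h | h
      · exact hω k h
      · exact hν k h
    · rw [wordProd_append, mul_assoc]
  · intro k hk
    exact hω k (List.mem_reverse.1 hk)
  · simp

lemma eq_of_not_descent {a b : B} {u : W} (hu : Minl cs a b u) {ω : List B} (hω : Two a b ω)
    (ha : ¬ cs.IsRightDescent (u * cs.wordProd ω) a)
    (hb : ¬ cs.IsRightDescent (u * cs.wordProd ω) b) : cs.wordProd ω = 1 := by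
  induction hn : ω.length using Nat.strong_induction_on generalizing ω with
  | _ n ih =>
  rcases List.eq_nil_or_concat ω with rfl | ⟨ν, i, rfl⟩
  · simp
  · rw [List.concat_eq_append] at *
    have hi : i = a ∨ i = b := hω i (by simp)
    have hν : Two a b ν := fun k hk => hω k (by simp [hk])
    have hnd : ¬ cs.IsRightDescent (u * cs.wordProd (ν ++ [i])) i := by
      rcases hi with rfl | rfl <;> assumption
    have hd : cs.IsRightDescent (u * cs.wordProd ν) i := by
      rw [isRightDescent_iff_not_isRightDescent_mul]
      simpa [wordProd_append, mul_assoc] using hnd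
    have hm := mem_ris_of_descent cs hu hν hi hd
    obtain ⟨j, hj, hji⟩ := List.mem_iff_getElem.1 hm
    have he := cs.wordProd_mul_getD_rightInvSeq ν j
    rw [List.getD_eq_getElem _ 1 hj, hji] at he
    have he' : cs.wordProd (ν ++ [i]) = cs.wordProd (ν.eraseIdx j) := by
      rw [wordProd_append, wordProd_singleton, he]
    rw [he'] at ha hb ⊢
    refine ih (ν.eraseIdx j).length ?_ ?_ ha hb rfl
    · have := List.length_eraseIdx_le ν j
      simp at hn
      omega
    · intro k hk
      exact hν k (List.mem_of_mem_eraseIdx hk)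

lemma step {a b : B} (hab : 3 ≤ orderOf (cs.simple a * cs.simple b)) {x : W}
    (ha : cs.IsRightDescent x a) (hb : cs.IsRightDescent x b) :
    cs.IsRightDescent (x * cs.simple a) b ∧
      cs.IsRightDescent (x * cs.simple a * cs.simple b) a := by
  have hne : cs.simple a ≠ cs.simple b := by
    intro h
    rw [h] at hab
    simp at hab
  have hne2 : cs.simple a * cs.simple b * cs.simple a ≠ cs.simple b := by
    intro h
    have : (cs.simple a * cs.simple b) ^ 2 = 1 := by
      rw [pow_two, ← mul_assoc, h]; simp
    have := orderOf_le_of_pow_eq_one (by norm_num) this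
    omega
  obtain ⟨u, hu, ω, hω, rfl⟩ := exists_decomp cs a b x
  have h1 : cs.IsRightDescent (u * cs.wordProd ω * cs.simple a) b := by
    by_contra hn
    have hn' := (cs.isRightDescent_iff_not_isRightDescent_mul).1 ha
    have e : u * cs.wordProd ω * cs.simple a = u * cs.wordProd (ω ++ [a]) := by
      simp [wordProd_append, mul_assoc]
    have h1 := eq_of_not_descent cs hu (ω := ω ++ [a])
      (by intro k hk
          rcases List.mem_append.1 hk with h | h
          · exact hω k h
          · left; simpa using h) (e ▸ hn') (e ▸ hn)
    have h2 : cs.wordProd ω = cs.wordProd [a] := by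
      rw [wordProd_append, mul_eq_one_iff_eq_inv] at h1
      simpa using h1
    rw [h2] at hb
    have := mem_ris_of_descent cs hu (ω := [a]) (by simp [Two]) (Or.inr rfl) hb
    simp at this
    exact hne this.symm
  refine ⟨h1, ?_⟩
  by_contra hn
  have hn' := (cs.isRightDescent_iff_not_isRightDescent_mul).1 h1
  have e : u * cs.wordProd ω * cs.simple a * cs.simple b = u * cs.wordProd (ω ++ [a, b]) := by
    simp [wordProd_append, wordProd_cons, mul_assoc]
  have h1 := eq_of_not_descent cs hu (ω := ω ++ [a, b])
    (by intro k hk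
        rcases List.mem_append.1 hk with h | h
        · exact hω k h
        · simpa using h) (e ▸ hn) (e ▸ hn')
  have h2 : cs.wordProd ω = cs.wordProd [b, a] := by
    rw [wordProd_append, mul_eq_one_iff_eq_inv] at h1
    simpa [wordProd_cons] using h1
  rw [h2] at hb
  have := mem_ris_of_descent cs hu (ω := [b, a]) (by simp [Two]) (Or.inr rfl) hb
  simp [rightInvSeq] at this
  rcases this with h | h
  · exact hne2 h.symm
  · exact hne h.symm

lemma no_chain (hcomp : ∀ s t : B, s ≠ t → 3 ≤ orderOf (cs.simple s * cs.simple t)) (n : ℕ) :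
    ∀ (x : W) (a b c : B), cs.length x = n → a ≠ b → b ≠ c → a ≠ c →
      cs.IsRightDescent x a → cs.IsRightDescent x b →
      cs.IsRightDescent (x * cs.simple a) c → False := by
  induction n using Nat.strong_induction_on with
  | _ n ih =>
  intro x a b c hx hab hbc hac ha hb hc
  have h1 := step cs (hcomp a b hab) ha hb
  have h2 := step cs (hcomp b c hbc) h1.1 hc
  exact ih _ (hx ▸ ha) (x * cs.simple a) b c a rfl hbc hac.symm hab.symm h1.1 hc h1.2

end CoxDesc

/-- Let `(W, S)` be a `2`-spherical Coxeter system of finite rank `n ≥ 3` whose Coxeter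
diagram is the complete graph. Then every `w ∈ W` has at most two right descents, i.e. the
set `{s ∈ S | ℓ(ws) < ℓ(w)}` has at most two elements. -/
theorem card_descents_le_two
    {B : Type*} [Fintype B] {W : Type*} [Group W] {M : CoxeterMatrix B}
    (cs : CoxeterSystem M W) (n : ℕ) (hn : Fintype.card B = n) (hn3 : 3 ≤ n)
    (h2sph : ∀ s t : B, orderOf (cs.simple s * cs.simple t) ≠ 0)
    (hcomp : ∀ s t : B, s ≠ t → 3 ≤ orderOf (cs.simple s * cs.simple t))
    (w : W) :
    {s : B | cs.length (w * cs.simple s) < cs.length w}.ncard ≤ 2 := by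
  by_contra hcon
  push Not at hcon
  obtain ⟨a, ha, b, hb, c, hc, hab, hac, hbc⟩ := (Set.two_lt_ncard (Set.toFinite _)).1 hcon
  exact CoxDesc.no_chain cs hcomp _ w a b c rfl hab hbc hac ha hb
    (CoxDesc.step cs (hcomp a c hac) ha hc).1
end

section
/- Let (W,S) be a Coxeter system of finite rank n ≥ 3 such that there exists m ≥ 3 with m_{st} = m for all s ≠ t ∈ S. Then for every natural number i > m one has c_i = d_i + ((n-2)(n-3)/2) · c_{i-m} + (n-2) · d_{i-m} (equivalently c_i - d_i = binom(n-2,2) c_{i-m} + (n-2) d_{i-m}). -/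
open CoxeterSystem
namespace CoxAux
variable {B : Type*} {W : Type*} [Group W] {M : CoxeterMatrix B} (cs : CoxeterSystem M W)

open Classical in
/-- Action of a simple reflection on signed elements. -/
noncomputable def gen (i : B) : Function.End (W × ZMod 2) :=
  fun p => (cs.simple i * p.1 * cs.simple i, p.2 + if p.1 = cs.simple i then 1 else 0)

lemma conj_eq_iff (i j : B) (n : ℕ) (t : W) :
    (cs.simple i * cs.simple j) ^ n * t * ((cs.simple i * cs.simple j) ^ n)⁻¹ = cs.simple j ↔
      t = (cs.simple j * cs.simple i) ^ (2 * n) * cs.simple j := by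
  have h : ∀ n : ℕ, cs.simple j * (cs.simple i * cs.simple j) ^ n
      = (cs.simple j * cs.simple i) ^ n * cs.simple j := by
    intro n
    induction n with
    | zero => simp
    | succ n ih => rw [pow_succ, ← mul_assoc, ih, pow_succ]; simp only [mul_assoc]
  have hinv : ((cs.simple i * cs.simple j) ^ n)⁻¹ = (cs.simple j * cs.simple i) ^ n := by
    rw [← inv_pow]; simp
  rw [mul_inv_eq_iff_eq_mul, h, ← eq_inv_mul_iff_mul_eq, hinv, ← mul_assoc, ← pow_add, two_mul]

lemma conj_eq_iff' (i j : B) (n : ℕ) (t : W) :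
    cs.simple j * ((cs.simple i * cs.simple j) ^ n * t * ((cs.simple i * cs.simple j) ^ n)⁻¹)
      * cs.simple j = cs.simple i ↔
      t = (cs.simple j * cs.simple i) ^ (2 * n + 1) * cs.simple j := by
  have h : ∀ n : ℕ, cs.simple j * (cs.simple i * cs.simple j) ^ n
      = (cs.simple j * cs.simple i) ^ n * cs.simple j := by
    intro n
    induction n with
    | zero => simp
    | succ n ih => rw [pow_succ, ← mul_assoc, ih, pow_succ]; simp only [mul_assoc]
  have hinv : ((cs.simple i * cs.simple j) ^ n)⁻¹ = (cs.simple j * cs.simple i) ^ n := by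
    rw [← inv_pow]; simp
  have e : ∀ x : W, cs.simple j * x * cs.simple j = cs.simple i ↔
      x = cs.simple j * cs.simple i * cs.simple j := by
    intro x
    constructor
    · intro hx; rw [← hx]; simp [mul_assoc]
    · rintro rfl; simp [mul_assoc]
  rw [e, mul_inv_eq_iff_eq_mul, mul_assoc (_ * _) (cs.simple j), h, ← eq_inv_mul_iff_mul_eq, hinv,
    ← mul_assoc, ← mul_assoc, ← pow_succ, ← pow_add]
  congr! 3
  omega

open Classical in
lemma gen_pow (i j : B) (n : ℕ) (t : W) (e : ZMod 2) :
    ((gen cs i * gen cs j) ^ n) (t, e) =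
      ((cs.simple i * cs.simple j) ^ n * t * ((cs.simple i * cs.simple j) ^ n)⁻¹,
        e + ∑ q ∈ Finset.range (2 * n),
          if t = (cs.simple j * cs.simple i) ^ q * cs.simple j then 1 else 0) := by
  induction n with
  | zero => simp; rfl
  | succ n ih =>
    rw [pow_succ']
    change gen cs i (gen cs j (((gen cs i * gen cs j) ^ n) (t, e))) = _
    rw [ih, show 2 * (n + 1) = 2 * n + 1 + 1 by ring, Finset.sum_range_succ, Finset.sum_range_succ]
    simp only [gen, conj_eq_iff, conj_eq_iff', Prod.mk.injEq]
    constructor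
    · rw [pow_succ']; simp [mul_assoc]
    · ring

lemma gen_liftable : M.IsLiftable (gen cs) := by
  classical
  intro i j
  funext ⟨t, e⟩
  rw [gen_pow, cs.simple_mul_simple_pow, two_mul, Finset.sum_range_add]
  have : ∀ q, (cs.simple j * cs.simple i) ^ (M i j + q) = (cs.simple j * cs.simple i) ^ q := by
    intro q; rw [pow_add, cs.simple_mul_simple_pow', one_mul]
  simp only [this]
  rw [CharTwo.add_self_eq_zero]
  simp; rfl

/-- The signed permutation representation. -/
noncomputable def phi : W →* Function.End (W × ZMod 2) := cs.lift ⟨gen cs, gen_liftable cs⟩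

lemma phi_simple (i : B) : phi cs (cs.simple i) = gen cs i := cs.lift_apply_simple _ i

lemma phi_fst_add (w t : W) (e : ZMod 2) :
    (phi cs w) (t, e) = (w * t * w⁻¹, e + ((phi cs w) (t, 0)).2) := by
  induction w using cs.simple_induction_left generalizing t e with
  | one => rw [map_one]; change (t, e) = (_, e + 0); simp
  | mul_simple_left w i ih =>
    rw [map_mul]
    change phi cs (cs.simple i) (phi cs w (t, e)) = 
      (_, e + (phi cs (cs.simple i) (phi cs w (t, 0))).2)
    rw [ih t e, ih t 0, phi_simple]
    simp only [gen, Prod.mk.injEq]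
    constructor
    · simp [mul_assoc]
    · ring

/-- The reflection cocycle. -/
noncomputable def eta (w t : W) : ZMod 2 := ((phi cs w) (t, 0)).2

lemma eta_mul (w x t : W) : eta cs (w * x) t = eta cs w (x * t * x⁻¹) + eta cs x t := by
  unfold eta
  rw [map_mul]
  change (phi cs w (phi cs x (t, 0))).2 = _
  rw [phi_fst_add cs x, phi_fst_add cs w]
  simp [add_comm]

open Classical in
lemma eta_simple (i : B) (t : W) : eta cs (cs.simple i) t = if t = cs.simple i then 1 else 0 := by
  unfold eta
  rw [phi_simple]
  simp [gen]

lemma eta_one (t : W) : eta cs 1 t = 0 := by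
  unfold eta; rw [map_one]; rfl

lemma eta_ne_zero (ω : List B) (t : W) (h : eta cs (cs.wordProd ω) t ≠ 0) :
    t ∈ cs.rightInvSeq ω := by
  induction ω with
  | nil => simp [eta_one] at h
  | cons i ω ih =>
    rw [cs.wordProd_cons, eta_mul, eta_simple] at h
    simp only [rightInvSeq, List.mem_cons]
    by_cases h1 : cs.wordProd ω * t * (cs.wordProd ω)⁻¹ = cs.simple i
    · left; rw [← h1]; group
    · right; apply ih; simpa [h1] using h

lemma lt_of_eta (w t : W) (h : eta cs w t ≠ 0) : cs.length (w * t) < cs.length w := by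
  obtain ⟨ω, hω, rfl⟩ := cs.exists_isReduced w
  exact (cs.isRightInversion_of_mem_rightInvSeq hω (eta_ne_zero cs ω t h)).2

lemma not_desc_of_eta (w : W) (i : B) (h : eta cs w (cs.simple i) = 0) :
    ¬ cs.IsRightDescent w i := by
  have := lt_of_eta cs (w * cs.simple i) (cs.simple i) (by rw [eta_mul, eta_simple]; simp [h])
  unfold IsRightDescent
  simp at this
  omega

/-- Alternating product ending in `y`. -/
def A (x y : B) (k : ℕ) : W := cs.wordProd (alternatingWord x y k)

@[simp] lemma A_zero (x y : B) : A cs x y 0 = 1 := by simp [A, alternatingWord]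

lemma A_succ (x y : B) (k : ℕ) : A cs x y (k+1) = A cs y x k * cs.simple y := by
  rw [A, alternatingWord_succ, wordProd_concat]; rfl

lemma A_succ_mul (x y : B) (k : ℕ) : A cs x y (k+1) * cs.simple y = A cs y x k := by
  rw [A_succ]; simp

lemma A_comm (x y : B) (m : ℕ) (h : (cs.simple x * cs.simple y) ^ m = 1) :
    A cs x y m = A cs y x m := by
  have hinv : ∀ n, (cs.simple y * cs.simple x) ^ n = ((cs.simple x * cs.simple y) ^ n)⁻¹ := by
    intro n; rw [← inv_pow]; simp
  unfold A
  rw [prod_alternatingWord_eq_mul_pow, prod_alternatingWord_eq_mul_pow, hinv]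
  rcases Nat.even_or_odd' m with ⟨q, rfl | rfl⟩
  · simp
    rw [eq_inv_iff_mul_eq_one, ← pow_add, ← two_mul, h]
  · have : (2 * q + 1) / 2 = q := by omega
    simp [this]
    rw [eq_mul_inv_iff_mul_eq, ← mul_right_inj (cs.simple x), mul_assoc, ← pow_add, ← mul_assoc,
      ← pow_succ', ← two_mul, h]
    simp

lemma eta_A (m : ℕ) (hM : ∀ s t : B, s ≠ t → orderOf (cs.simple s * cs.simple t) = m)
    (k p : ℕ) (x y : B) (hxy : x ≠ y) (h : k + p < m) :
    eta cs (A cs x y k) (cs.simple x * (cs.simple y * cs.simple x) ^ p) = 0 := by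
  induction k generalizing x y p with
  | zero => simp [eta_one]
  | succ k ih =>
    rw [A_succ, eta_mul, eta_simple]
    have e : ∀ p, cs.simple x * (cs.simple y * cs.simple x) ^ p * cs.simple y
        = (cs.simple x * cs.simple y) ^ (p + 1) := by
      intro p
      induction p with
      | zero => simp
      | succ n ih => rw [pow_succ _ (n+1), ← ih, pow_succ]; simp only [mul_assoc]
    have h1 : cs.simple x * (cs.simple y * cs.simple x) ^ p ≠ cs.simple y := by
      intro hc
      have := e p
      rw [hc, cs.simple_mul_simple_self] at this
      exact pow_ne_one_of_lt_orderOf (by omega) (by rw [hM x y hxy]; omega) this.symm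
    have := ih (p + 1) y x hxy.symm (by omega)
    rw [inv_simple, mul_assoc, e p, this, if_neg h1, add_zero]

lemma eta_A' (m : ℕ) (hM : ∀ s t : B, s ≠ t → orderOf (cs.simple s * cs.simple t) = m)
    (k : ℕ) (x y : B) (hxy : x ≠ y) (h : k < m) :
    eta cs (A cs x y k) (cs.simple x) = 0 := by
  simpa using eta_A cs m hM k 0 x y hxy h


/-- The rank two parabolic subgroup. -/
def H (a b : B) : Subgroup W := Subgroup.closure {cs.simple a, cs.simple b}

lemma H_comm (a b : B) : H cs a b = H cs b a := by
  unfold H; rw [Set.pair_comm]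

lemma left_mem_H (a b : B) : cs.simple a ∈ H cs a b := Subgroup.subset_closure (by simp)

lemma right_mem_H (a b : B) : cs.simple b ∈ H cs a b := Subgroup.subset_closure (by simp)

lemma A_mem_H (a b : B) (k : ℕ) : A cs a b k ∈ H cs a b := by
  induction k generalizing a b with
  | zero => simp [one_mem]
  | succ k ih =>
    rw [A_succ]
    exact mul_mem (H_comm cs a b ▸ ih b a) (right_mem_H cs a b)

lemma length_min (m : ℕ) (hM : ∀ s t : B, s ≠ t → orderOf (cs.simple s * cs.simple t) = m)
    (v : W) (k : ℕ) (hk : k ≤ m) (a b : B) (hab : a ≠ b)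
    (hmin : ∀ h ∈ H cs a b, cs.length v ≤ cs.length (v * h)) :
    cs.length (v * A cs a b k) = cs.length v + k := by
  induction k generalizing a b with
  | zero => simp
  | succ k ih =>
    have h1 := ih (by omega) b a hab.symm (by rw [H_comm]; exact hmin)
    have h2 : eta cs (v * A cs b a k) (cs.simple b) = 0 := by
      rw [eta_mul, eta_A' cs m hM k b a hab.symm (by omega), add_zero]
      by_contra hc
      have h3 := lt_of_eta cs _ _ hc
      have hA : A cs b a k ∈ H cs a b := H_comm cs a b ▸ A_mem_H cs b a k
      have h4 := hmin _ (mul_mem (mul_mem hA (right_mem_H cs a b)) (inv_mem hA))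
      omega
    have h3 := (cs.not_isRightDescent_iff).1 (not_desc_of_eta cs _ _ h2)
    rw [A_succ, ← mul_assoc, h3, h1]; ring

lemma exists_min (w : W) (a b : B) :
    ∃ v, v⁻¹ * w ∈ H cs a b ∧ ∀ h ∈ H cs a b, cs.length v ≤ cs.length (v * h) := by
  classical
  have hne : ∃ n, ∃ h ∈ H cs a b, cs.length (w * h) = n := ⟨_, 1, one_mem _, rfl⟩
  obtain ⟨h, hh, hl⟩ := Nat.find_spec hne
  refine ⟨w * h, by simpa using hh, fun g hg => ?_⟩
  rw [hl]
  exact Nat.find_min' hne ⟨h * g, mul_mem hh hg, by rw [mul_assoc]⟩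

lemma H_form (m : ℕ) (hm : 3 ≤ m)
    (hM : ∀ s t : B, s ≠ t → orderOf (cs.simple s * cs.simple t) = m)
    (a b : B) (hab : a ≠ b) (h : W) (hh : h ∈ H cs a b) :
    ∃ k ≤ m, h = A cs a b k ∨ h = A cs b a k := by
  have comm : A cs a b m = A cs b a m := A_comm cs a b m (by rw [← hM a b hab, pow_orderOf_eq_one])
  have key : ∀ x y : B, A cs x y m = A cs y x m → ∀ k ≤ m, ∀ g, g = A cs x y k →
      (∃ k' ≤ m, g * cs.simple x = A cs x y k' ∨ g * cs.simple x = A cs y x k') ∧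
      (∃ k' ≤ m, g * cs.simple y = A cs x y k' ∨ g * cs.simple y = A cs y x k') := by
    rintro x y hc k hk g rfl
    constructor
    · rcases hk.lt_or_eq with hlt | rfl
      · exact ⟨k + 1, hlt, Or.inr (A_succ cs y x k).symm⟩
      · obtain ⟨j, rfl⟩ : ∃ j, k = j + 1 := ⟨k - 1, by omega⟩
        exact ⟨j, by omega, Or.inl (by rw [hc, A_succ_mul])⟩
    · cases k with
      | zero => exact ⟨1, by omega, Or.inl (by rw [A_succ]; simp)⟩
      | succ j => exact ⟨j, by omega, Or.inr (A_succ_mul cs x y j)⟩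
  have step : ∀ g : W, (∃ k ≤ m, g = A cs a b k ∨ g = A cs b a k) →
      (∃ k ≤ m, g * cs.simple a = A cs a b k ∨ g * cs.simple a = A cs b a k) ∧
      (∃ k ≤ m, g * cs.simple b = A cs a b k ∨ g * cs.simple b = A cs b a k) := by
    rintro g ⟨k, hk, hg | hg⟩
    · exact key a b comm k hk g hg
    · obtain ⟨⟨k1, h1, h1'⟩, ⟨k2, h2, h2'⟩⟩ := key b a comm.symm k hk g hg
      exact ⟨⟨k2, h2, h2'.symm⟩, ⟨k1, h1, h1'.symm⟩⟩
  induction hh using Subgroup.closure_induction_right with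
  | one => exact ⟨0, by omega, by simp⟩
  | mul_right x y _ hy ih =>
    rcases hy with rfl | rfl
    · exact (step _ ih).1
    · exact (step _ ih).2
  | mul_inv_cancel x y _ hy ih =>
    rcases hy with rfl | rfl
    · rw [inv_simple]; exact (step _ ih).1
    · rw [inv_simple]; exact (step _ ih).2

/-- Coset decomposition. -/
lemma coset (m : ℕ) (hm : 3 ≤ m)
    (hM : ∀ s t : B, s ≠ t → orderOf (cs.simple s * cs.simple t) = m)
    (a b : B) (hab : a ≠ b) (w : W) :
    ∃ v, (∀ k ≤ m, cs.length (v * A cs a b k) = cs.length v + k ∧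
      cs.length (v * A cs b a k) = cs.length v + k) ∧
      ∃ k ≤ m, w = v * A cs a b k ∨ w = v * A cs b a k := by
  obtain ⟨v, hv, hmin⟩ := exists_min cs w a b
  obtain ⟨k, hk, h⟩ := H_form cs m hm hM a b hab _ hv
  refine ⟨v, fun k hk => ⟨length_min cs m hM v k hk a b hab hmin,
    length_min cs m hM v k hk b a hab.symm (by rw [H_comm]; exact hmin)⟩, k, hk, ?_⟩
  simpa [inv_mul_eq_iff_eq_mul] using h

lemma length_up (m : ℕ) (hm : 3 ≤ m)
    (hM : ∀ s t : B, s ≠ t → orderOf (cs.simple s * cs.simple t) = m)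
    (a b : B) (hab : a ≠ b) (u : W) (ha : ¬ cs.IsRightDescent u a) (hb : ¬ cs.IsRightDescent u b)
    (k : ℕ) (hk : k ≤ m) : cs.length (u * A cs a b k) = cs.length u + k := by
  obtain ⟨v, hv, j, hj, h⟩ := coset cs m hm hM a b hab u
  cases j with
  | zero =>
    have : u = v := by simpa using h
    rw [this]; exact (hv k hk).1
  | succ j =>
    exfalso
    have h1 := hv (j + 1) hj
    have h2 := hv j (by omega)
    rcases h with h | h
    · apply hb
      rw [IsRightDescent, h, mul_assoc, A_succ_mul]; omega
    · apply ha
      rw [IsRightDescent, h, mul_assoc, A_succ_mul]; omega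

lemma two_desc (m : ℕ) (hm : 3 ≤ m)
    (hM : ∀ s t : B, s ≠ t → orderOf (cs.simple s * cs.simple t) = m)
    (a b : B) (hab : a ≠ b) (w : W) (ha : cs.IsRightDescent w a) (hb : cs.IsRightDescent w b) :
    ∃ v, w = v * A cs a b m ∧ cs.length w = cs.length v + m ∧ ¬ cs.IsRightDescent v a ∧
      ¬ cs.IsRightDescent v b := by
  obtain ⟨v, hv, j, hj, h⟩ := coset cs m hm hM a b hab w
  have comm : A cs a b m = A cs b a m := A_comm cs a b m (by rw [← hM a b hab, pow_orderOf_eq_one])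
  rcases hj.lt_or_eq with hlt | rfl
  · exfalso
    have h1 := hv (j + 1) hlt
    have h2 := hv j (by omega)
    rcases h with h | h
    · rw [IsRightDescent, h, mul_assoc, ← A_succ] at ha; omega
    · rw [IsRightDescent, h, mul_assoc, ← A_succ] at hb; omega
  · rw [← comm, or_self] at h
    have h1 := hv 1 (by omega)
    simp only [A_succ, A_zero, one_mul] at h1
    refine ⟨v, h, h ▸ (hv j le_rfl).1, ?_, ?_⟩ <;> rw [IsRightDescent] <;> omega

lemma desc_up (m : ℕ) (hm : 3 ≤ m)
    (hM : ∀ s t : B, s ≠ t → orderOf (cs.simple s * cs.simple t) = m)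
    (a b : B) (hab : a ≠ b) (u : W) (ha : ¬ cs.IsRightDescent u a)
    (hb : ¬ cs.IsRightDescent u b) :
    cs.IsRightDescent (u * A cs a b m) b := by
  have h1 := length_up cs m hm hM a b hab u ha hb m le_rfl
  have h2 := length_up cs m hm hM b a hab.symm u hb ha (m - 1) (by omega)
  obtain ⟨j, rfl⟩ : ∃ j, m = j + 1 := ⟨m - 1, by omega⟩
  rw [IsRightDescent, mul_assoc, A_succ_mul]
  simp at h2
  omega

lemma no_three (m : ℕ) (hm : 3 ≤ m)
    (hM : ∀ s t : B, s ≠ t → orderOf (cs.simple s * cs.simple t) = m)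
    (x : ℕ → B) (h1 : ∀ k, x k ≠ x (k + 1)) (h2 : ∀ k, x k ≠ x (k + 2))
    (w : W) (hw : ∀ k, cs.IsRightDescent w (x k)) : False := by
  -- the descending sequence
  let v : ℕ → W := fun k => Nat.rec w (fun j z => z * cs.simple (x j)) k
  have v0 : v 0 = w := rfl
  have vs : ∀ k, v (k + 1) = v k * cs.simple (x k) := fun k => rfl
  have vs' : ∀ k, v (k + 1) * cs.simple (x k) = v k := fun k => by rw [vs]; simp
  have up : ∀ z : W, ∀ a b : B, a ≠ b → ¬ cs.IsRightDescent z a → ¬ cs.IsRightDescent z b →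
      ¬ cs.IsRightDescent (z * cs.simple a) b ∧
      ¬ cs.IsRightDescent (z * cs.simple a * cs.simple b) a := by
    intro z a b hab ha hb
    have e1 := length_up cs m hm hM b a hab.symm z hb ha 1 (by omega)
    have e2 := length_up cs m hm hM a b hab z ha hb 2 (by omega)
    have e3 := length_up cs m hm hM b a hab.symm z hb ha 3 (by omega)
    simp only [A_succ, A_zero, one_mul, ← mul_assoc] at e1 e2 e3
    simp only [IsRightDescent]
    omega
  have main : ∀ k, cs.length (v k) + k = cs.length w ∧
      ∀ j, ¬ cs.IsRightDescent (v k) (x j) → 0 < k ∧ x j = x (k - 1) := by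
    intro k
    induction k using Nat.strong_induction_on with
    | _ k ih =>
      match k with
      | 0 => exact ⟨by simp [v0], fun j hj => absurd (hw j) hj⟩
      | k + 1 =>
        have hd : cs.IsRightDescent (v k) (x k) := by
          by_contra hc
          obtain ⟨hpos, he⟩ := (ih k (by omega)).2 k hc
          obtain ⟨q, rfl⟩ : ∃ q, k = q + 1 := ⟨k - 1, by omega⟩
          exact h1 q he.symm
        have hl := (cs.isRightDescent_iff).1 hd
        rw [← vs] at hl
        refine ⟨by have := (ih k (by omega)).1; omega, fun j hj => ⟨by omega, ?_⟩⟩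
        by_contra hne
        simp only [Nat.add_sub_cancel] at hne
        have hn : ¬ cs.IsRightDescent (v (k + 1)) (x k) := by
          rw [IsRightDescent, vs']; omega
        obtain ⟨u1, u2⟩ := up _ _ _ (Ne.symm hne) hn hj
        rw [vs'] at u1 u2
        obtain ⟨hpos, he⟩ := (ih k (by omega)).2 j u1
        obtain ⟨q, rfl⟩ : ∃ q, k = q + 1 := ⟨k - 1, by omega⟩
        simp only [Nat.add_sub_cancel] at he
        rw [he, vs'] at u2
        obtain ⟨hpos, he'⟩ := (ih q (by omega)).2 _ u2
        obtain ⟨p, rfl⟩ : ∃ p, q = p + 1 := ⟨q - 1, by omega⟩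
        simp only [Nat.add_sub_cancel] at he'
        exact h2 p he'.symm
  have := (main (cs.length w + 1)).1
  omega

lemma no_three' (m : ℕ) (hm : 3 ≤ m)
    (hM : ∀ s t : B, s ≠ t → orderOf (cs.simple s * cs.simple t) = m)
    (a b c : B) (hab : a ≠ b) (hac : a ≠ c) (hbc : b ≠ c) (w : W) (ha : cs.IsRightDescent w a)
    (hb : cs.IsRightDescent w b) (hc : cs.IsRightDescent w c) : False := by
  have hlt : ∀ k, k % 3 = 0 ∨ k % 3 = 1 ∨ k % 3 = 2 := by intro k; omega
  refine no_three cs m hm hM (fun k => if k % 3 = 0 then a else if k % 3 = 1 then b else c)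
    ?_ ?_ w ?_
  · intro k; rcases hlt k with h | h | h <;> simp [Nat.add_mod, h, hab, hac.symm, hbc]
  · intro k; rcases hlt k with h | h | h <;> simp [Nat.add_mod, h, hab.symm, hac, hbc.symm]
  · intro k; rcases hlt k with h | h | h <;> simp [h, ha, hb, hc]

lemma finite_length [Finite B] (i : ℕ) : {w : W | cs.length w = i}.Finite := by
  refine (List.finite_length_eq B i).image cs.wordProd |>.subset ?_
  rintro w rfl
  obtain ⟨ω, hω, rfl⟩ := cs.exists_isReduced w
  exact ⟨ω, hω.symm, rfl⟩

end CoxAux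

open CoxAux in
/-- Let `(W, S)` be a Coxeter system of finite rank `n ≥ 3` such that there exists `m ≥ 3`
with `m s t = m` for all `s ≠ t` in `S`. Let `c i` be the number of elements of length `i`
and `d i` the number of elements of length `i` with exactly one right descent. Then for
every `i > m` one has `c i = d i + (n-2 choose 2) * c (i - m) + (n - 2) * d (i - m)`. -/
theorem c_sub_d_eq
    {B : Type*} [Fintype B] {W : Type*} [Group W] {M : CoxeterMatrix B}
    (cs : CoxeterSystem M W) (n : ℕ) (hn : Fintype.card B = n) (hn3 : 3 ≤ n)
    (m : ℕ) (hm : 3 ≤ m)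
    (hM : ∀ s t : B, s ≠ t → orderOf (cs.simple s * cs.simple t) = m)
    (c d : ℕ → ℕ)
    (hc : ∀ i, c i = Nat.card {w : W // cs.length w = i})
    (hd : ∀ i, d i = Nat.card {w : W // cs.length w = i ∧
      ∃! s : B, cs.length (w * cs.simple s) < cs.length w})
    (i : ℕ) (hi : m < i) :
    c i = d i + Nat.choose (n - 2) 2 * c (i - m) + (n - 2) * d (i - m) := by
  classical
  let X : ℕ → Finset W := fun j => (finite_length cs j).toFinset
  have hX : ∀ j w, w ∈ X j ↔ cs.length w = j := by intro j w; simp [X]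
  let D : W → Finset B := fun w => Finset.univ.filter fun s => cs.IsRightDescent w s
  have hD : ∀ w s, s ∈ D w ↔ cs.IsRightDescent w s := by intro w s; simp [D]
  have hc' : ∀ j, c j = (X j).card := by
    intro j
    rw [hc, Nat.subtype_card]
    exact fun w => hX j w
  have hd' : ∀ j, d j = ((X j).filter fun w => (D w).card = 1).card := by
    intro j
    rw [hd, Nat.subtype_card]
    intro w
    rw [Finset.mem_filter, hX, Finset.card_eq_one, Finset.singleton_iff_unique_mem]
    simp only [hD]; rfl
  have hle : ∀ w, (D w).card ≤ 2 := by
    intro w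
    by_contra hlt
    obtain ⟨a, ha, b, hb, e, he, hab, hae, hbe⟩ := Finset.two_lt_card.1 (not_le.1 hlt)
    exact no_three' cs m hm hM a b e hab hae hbe w ((hD _ _).1 ha) ((hD _ _).1 hb) ((hD _ _).1 he)
  have hpos : ∀ j, 0 < j → ∀ w ∈ X j, 1 ≤ (D w).card := by
    intro j hj w hw
    have : w ≠ 1 := by
      rintro rfl
      rw [hX] at hw; simp at hw; omega
    obtain ⟨s, hs⟩ := cs.exists_rightDescent_of_ne_one this
    exact Finset.card_pos.2 ⟨s, (hD _ _).2 hs⟩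
  have hsplit : ∀ j, 0 < j → c j = d j + ((X j).filter fun w => (D w).card = 2).card := by
    intro j hj
    rw [hc', hd', ← Finset.card_filter_add_card_filter_not (s := X j) (fun w => (D w).card = 1)]
    congr 2
    apply Finset.filter_congr
    intro w hw
    have := hpos j hj w hw
    have := hle w
    omega
  have hcount : ∑ w ∈ X i, (D w).offDiag.card = ∑ u ∈ X (i - m), ((D u)ᶜ).offDiag.card := by
    have e1 : ∀ w, (D w).offDiag.card = ((Finset.univ : Finset B).offDiag.filter
        fun p => p.1 ∈ D w ∧ p.2 ∈ D w).card := by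
      intro w; congr 1; ext p; simp; tauto
    have e2 : ∀ w, ((D w)ᶜ).offDiag.card = ((Finset.univ : Finset B).offDiag.filter
        fun p => p.1 ∉ D w ∧ p.2 ∉ D w).card := by
      intro w; congr 1; ext p; simp; tauto
    simp only [e1, e2, Finset.card_filter]
    rw [Finset.sum_comm, Finset.sum_comm (s := X (i - m))]
    apply Finset.sum_congr rfl
    rintro ⟨a, b⟩ hp
    have hab : a ≠ b := by simpa using hp
    rw [← Finset.card_filter, ← Finset.card_filter]
    symm
    refine Finset.card_bij (fun u _ => u * A cs a b m) ?_ ?_ ?_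
    · intro u hu
      simp only [Finset.mem_filter, hX, hD] at hu ⊢
      obtain ⟨hl, ha, hb⟩ := hu
      have comm : A cs a b m = A cs b a m :=
        A_comm cs a b m (by rw [← hM a b hab, pow_orderOf_eq_one])
      refine ⟨?_, ?_, desc_up cs m hm hM a b hab u ha hb⟩
      · rw [length_up cs m hm hM a b hab u ha hb m le_rfl]; omega
      · rw [comm]; exact desc_up cs m hm hM b a hab.symm u hb ha
    · intro u _ v _ h; exact mul_right_cancel h
    · intro w hw
      simp only [Finset.mem_filter, hX, hD] at hw
      obtain ⟨hl, ha, hb⟩ := hw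
      obtain ⟨v, hv, hlv, hva, hvb⟩ := two_desc cs m hm hM a b hab w ha hb
      refine ⟨v, ?_, hv.symm⟩
      simp only [Finset.mem_filter, hX, hD]
      exact ⟨by omega, hva, hvb⟩
  have hL : ∀ (j : ℕ), 0 < j → ∀ (F : ℕ → ℕ), ∑ w ∈ X j, F (D w).card = 
      F 1 * d j + F 2 * ((X j).filter fun w => (D w).card = 2).card := by
    intro j hj F
    rw [hd', Finset.card_filter, Finset.card_filter, Finset.mul_sum, Finset.mul_sum,
      ← Finset.sum_add_distrib]
    apply Finset.sum_congr rfl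
    intro w hw
    have h1 := hpos j hj w hw
    have h2 := hle w
    have : (D w).card = 1 ∨ (D w).card = 2 := by omega
    rcases this with h | h <;> simp [h]
  have hA := hL i (by omega) (fun k => k * k - k)
  have hB := hL (i - m) (by omega) (fun k => (n - k) * (n - k) - (n - k))
  simp only [Finset.offDiag_card, Finset.card_compl, hn] at hcount
  rw [hA, hB] at hcount
  rw [hsplit i (by omega), hsplit (i - m) (by omega)]
  obtain ⟨k, rfl⟩ : ∃ k, n = k + 3 := ⟨n - 3, by omega⟩
  have hch : Nat.choose (k + 3 - 2) 2 * 2 = (k + 1) * k := by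
    rw [show k + 3 - 2 = k + 1 by omega, Nat.choose_two_right,
      Nat.div_mul_cancel (Nat.even_mul_pred_self (k + 1)).two_dvd, Nat.add_sub_cancel]
  generalize Nat.choose (k + 3 - 2) 2 = C at *
  have t1 : (k + 3 - 1) * (k + 3 - 1) - (k + 3 - 1) = (k + 2) * (k + 1) := by
    rw [show k + 3 - 1 = k + 2 by omega, ← Nat.mul_sub_one]; rfl
  have t2 : (k + 3 - 2) * (k + 3 - 2) - (k + 3 - 2) = (k + 1) * k := by
    rw [show k + 3 - 2 = k + 1 by omega, ← Nat.mul_sub_one]; rfl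
  rw [t1, t2] at hcount
  simp only [show k + 3 - 2 = k + 1 by omega]
  norm_num at hcount
  generalize ((X i).filter fun w => (D w).card = 2).card = e at *
  generalize ((X (i - m)).filter fun w => (D w).card = 2).card = e' at *
  generalize d (i - m) = d' at *
  have h4 : C * 2 * (d' + e') = (k + 1) * k * (d' + e') := by rw [hch]
  nlinarith
end

section
/- Let (W,S) be a Coxeter system of finite rank n ≥ 3 such that there exists m ≥ 4 with m_{st} = m for all s ≠ t ∈ S. Then for every natural number i > m one has (n-2)·c_i ≤ c_{i+1}. -/
namespace CoxLB

open CoxeterSystem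

variable {B : Type*} {W : Type*} [Group W] {M : CoxeterMatrix B}

section exchange

open Classical in
/-- The permutation of `W × ZMod 2` attached to an involution `s`. -/
noncomputable def refl (s : W) (hs : s * s = 1) : Equiv.Perm (W × ZMod 2) where
  toFun p := (s * p.1 * s, p.2 + if p.1 = s then 1 else 0)
  invFun p := (s * p.1 * s, p.2 + if p.1 = s then 1 else 0)
  left_inv := by
    rintro ⟨x, e⟩
    have h1 : s * (s * x * s) * s = x := by
      calc s * (s * x * s) * s = (s * s) * x * (s * s) := by group
        _ = x := by simp [hs]
    have h2 : s * x * s = s ↔ x = s := by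
      constructor
      · intro h
        rw [← h1, h, hs, one_mul]
      · rintro rfl
        rw [hs, one_mul]
    simp only [h1, h2, Prod.mk.injEq, true_and]
    split_ifs
    · rw [add_assoc, CharTwo.add_self_eq_zero, add_zero]
    · simp
  right_inv := by
    rintro ⟨x, e⟩
    have h1 : s * (s * x * s) * s = x := by
      calc s * (s * x * s) * s = (s * s) * x * (s * s) := by group
        _ = x := by simp [hs]
    have h2 : s * x * s = s ↔ x = s := by
      constructor
      · intro h
        rw [← h1, h, hs, one_mul]
      · rintro rfl
        rw [hs, one_mul]
    simp only [h1, h2, Prod.mk.injEq, true_and]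
    split_ifs
    · rw [add_assoc, CharTwo.add_self_eq_zero, add_zero]
    · simp

open Classical in
theorem refl_apply (s : W) (hs : s * s = 1) (x : W) (e : ZMod 2) :
    refl s hs (x, e) = (s * x * s, e + if x = s then 1 else 0) := rfl

theorem pow_mul_flip (a b : W) (ha : a * a = 1) (hb : b * b = 1) (p : ℕ) :
    (a * b) ^ p * b * (a * b) ^ p = b := by
  induction p with
  | zero => simp
  | succ p ih =>
    have : (a * b) ^ (p + 1) * b * (a * b) ^ (p + 1)
        = (a * b) * ((a * b) ^ p * b * (a * b) ^ p) * (a * b) := by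
      rw [pow_succ' (a * b) p]
      nth_rewrite 2 [← pow_succ']
      rw [pow_succ]
      group
    rw [this, ih]
    calc a * b * b * (a * b) = a * (b * b) * a * b := by group
      _ = b := by rw [hb, mul_one, ha, one_mul]

open Classical in
theorem refl_pow (a b : W) (ha : a * a = 1) (hb : b * b = 1) (p : ℕ) (x : W) (e : ZMod 2) :
    ((refl a ha * refl b hb) ^ p) (x, e) =
      ((a * b) ^ p * x * ((a * b) ^ p)⁻¹,
        e + ∑ k ∈ Finset.range (2 * p), if x = b * (a * b) ^ k then 1 else 0) := by
  induction p with
  | zero => simp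
  | succ p ih =>
    rw [pow_succ', Equiv.Perm.mul_apply, ih, Equiv.Perm.mul_apply, refl_apply, refl_apply]
    have hai : a⁻¹ = a := inv_eq_of_mul_eq_one_left ha
    have hbi : b⁻¹ = b := inv_eq_of_mul_eq_one_left hb
    have hflip := pow_mul_flip a b ha hb p
    set r := (a * b) ^ p with hr
    have e1 : r * x * r⁻¹ = b ↔ x = b * (a * b) ^ (2 * p) := by
      have : (a * b) ^ (2 * p) = r * r := by rw [two_mul, pow_add]
      rw [this]
      have h3 : r⁻¹ * b * r = b * (r * r) := by
        nth_rewrite 1 [← hflip]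
        group
      rw [← h3]
      constructor
      · intro h; rw [← h]; group
      · intro h; rw [h]; group
    have e2 : b * (r * x * r⁻¹) * b = a ↔ x = b * (a * b) ^ (2 * p + 1) := by
      have : (a * b) ^ (2 * p + 1) = r * (a * b) * r := by
        rw [two_mul, hr, ← pow_succ, ← pow_add]; congr 1; omega
      rw [this]
      have h3 : r⁻¹ * (b * a * b) * r = b * (r * (a * b) * r) := by
        have h4 : r⁻¹ * b = b * r := by
          nth_rewrite 1 [← hflip]
          group
        calc r⁻¹ * (b * a * b) * r = (r⁻¹ * b) * (a * b) * r := by group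
          _ = _ := by rw [h4]; group
      rw [← h3]
      constructor
      · intro h
        have : b * a * b = r * x * r⁻¹ := by
          rw [← h]
          calc b * (b * (r * x * r⁻¹) * b) * b = (b * b) * (r * x * r⁻¹) * (b * b) := by group
            _ = _ := by rw [hb]; group
        rw [this]; group
      · intro h; rw [h]
        calc b * (r * (r⁻¹ * (b * a * b) * r) * r⁻¹) * b = (b * b) * a * (b * b) := by group
          _ = a := by rw [hb]; group
    simp only [e1, e2]
    rw [Prod.mk.injEq]
    constructor
    · rw [pow_succ', ← hr, mul_inv_rev, mul_inv_rev, hai, hbi]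
      group
    · rw [show 2 * (p + 1) = 2 * p + 1 + 1 by ring, Finset.sum_range_succ, Finset.sum_range_succ]
      ring

theorem liftable (cs : CoxeterSystem M W) :
    M.IsLiftable (fun i => refl (cs.simple i) (cs.simple_mul_simple_self i)) := by
  classical
  intro i j
  ext1 ⟨x, e⟩
  rw [refl_pow, cs.simple_mul_simple_pow, two_mul, Finset.sum_range_add]
  simp only [pow_add, cs.simple_mul_simple_pow, one_mul, CharTwo.add_self_eq_zero]
  simp

/-- The reflection cocycle action. -/
noncomputable def act (cs : CoxeterSystem M W) : W →* Equiv.Perm (W × ZMod 2) :=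
  cs.lift ⟨_, liftable cs⟩

theorem act_simple (cs : CoxeterSystem M W) (i : B) :
    act cs (cs.simple i) = refl (cs.simple i) (cs.simple_mul_simple_self i) :=
  cs.lift_apply_simple _ i

open Classical in
theorem act_word (cs : CoxeterSystem M W) (ω : List B) (x : W) (e : ZMod 2) :
    act cs (cs.wordProd ω) (x, e) =
      (cs.wordProd ω * x * (cs.wordProd ω)⁻¹, e + ((cs.rightInvSeq ω).count x : ℕ)) := by
  induction ω with
  | nil => simp
  | cons i ω ih =>
    rw [cs.wordProd_cons, map_mul, Equiv.Perm.mul_apply, ih, act_simple, refl_apply]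
    have h : cs.wordProd ω * x * (cs.wordProd ω)⁻¹ = cs.simple i ↔
        (cs.wordProd ω)⁻¹ * cs.simple i * cs.wordProd ω = x := by
      constructor
      · intro h; rw [← h]; group
      · intro h; rw [← h]; group
    rw [Prod.mk.injEq]
    constructor
    · rw [mul_inv_rev, cs.inv_simple]; group
    · rw [rightInvSeq, List.count_cons]
      simp only [h, beq_iff_eq]
      push_cast
      ring

theorem exchange (cs : CoxeterSystem M W) (ω : List B) (b : B)
    (h : cs.IsRightDescent (cs.wordProd ω) b) :
    ∃ j < ω.length, cs.wordProd ω * cs.simple b = cs.wordProd (ω.eraseIdx j) := by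
  classical
  obtain ⟨τ, hτ, hτ'⟩ := cs.exists_isReduced (cs.wordProd ω * cs.simple b)
  have h0 : cs.simple b ∉ cs.rightInvSeq τ := by
    intro hmem
    have := (cs.isRightInversion_of_mem_rightInvSeq hτ hmem).2
    rw [← hτ', cs.simple_mul_simple_cancel_right] at this
    unfold IsRightDescent at h
    omega
  have h1 := act_word cs τ (cs.simple b) 0
  rw [← hτ', map_mul, Equiv.Perm.mul_apply, act_simple, refl_apply, cs.simple_mul_simple_self,
    one_mul, if_pos rfl, act_word, List.count_eq_zero.mpr h0] at h1
  have h2 := congrArg Prod.snd h1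
  have hmem : cs.simple b ∈ cs.rightInvSeq ω := by
    by_contra hn
    rw [List.count_eq_zero.mpr hn] at h2
    revert h2
    simp
  obtain ⟨j, hj, hj'⟩ := List.mem_iff_getElem.mp hmem
  refine ⟨j, by simpa using hj, ?_⟩
  rw [← cs.wordProd_mul_getD_rightInvSeq, List.getD_eq_getElem _ 1 hj, hj']

/-- Exchange relative to a suffix. -/
theorem exchange_suffix (cs : CoxeterSystem M W) (y : W) (τ : List B) (b : B)
    (h : cs.IsRightDescent (y * cs.wordProd τ) b) :
    (∃ j < τ.length, cs.wordProd τ * cs.simple b = cs.wordProd (τ.eraseIdx j)) ∨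
    ∃ y', cs.length y' < cs.length y ∧
      y * cs.wordProd τ * cs.simple b = y' * cs.wordProd τ := by
  obtain ⟨ω, hω, rfl⟩ := cs.exists_isReduced y
  rw [← cs.wordProd_append] at h
  obtain ⟨j, hj, hj'⟩ := exchange cs _ b h
  by_cases hjω : j < ω.length
  · right
    refine ⟨cs.wordProd (ω.eraseIdx j), ?_, ?_⟩
    · have := cs.length_wordProd_le (ω.eraseIdx j)
      have h3 := List.length_eraseIdx_add_one hjω
      rw [hω.eq]
      omega
    · rw [← cs.wordProd_append, hj', List.eraseIdx_append_of_lt_length hjω, cs.wordProd_append]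
  · left
    push Not at hjω
    rw [List.length_append] at hj
    refine ⟨j - ω.length, by omega, ?_⟩
    rw [List.eraseIdx_append_of_length_le hjω, cs.wordProd_append, cs.wordProd_append,
      mul_assoc] at hj'
    exact mul_left_cancel hj'

end exchange

section dihedral

variable (cs : CoxeterSystem M W)

theorem desc_step {w y : W} {τ : List B} {b : B} (hw : w = y * cs.wordProd τ)
    (hl : cs.length w = cs.length y + τ.length) (h : cs.IsRightDescent w b)
    (hno : ∀ j < τ.length, cs.wordProd τ * cs.simple b ≠ cs.wordProd (τ.eraseIdx j)) :
    ∃ y', w = y' * cs.wordProd (τ ++ [b]) ∧ cs.length w = cs.length y' + (τ ++ [b]).length := by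
  have h' := h
  rw [hw] at h'
  rcases exchange_suffix cs y τ b h' with ⟨j, hj, hj'⟩ | ⟨y', hy', hy''⟩
  · exact absurd hj' (hno j hj)
  · have h1 : w = y' * cs.wordProd (τ ++ [b]) := by
      rw [cs.wordProd_append, ← mul_assoc, ← hy'', ← hw, cs.wordProd_singleton,
        cs.simple_mul_simple_cancel_right]
    refine ⟨y', h1, ?_⟩
    have h2 := cs.length_mul_le y' (cs.wordProd (τ ++ [b]))
    have h3 := cs.length_wordProd_le (τ ++ [b])
    rw [← h1] at h2
    simp only [List.length_append, List.length_singleton] at *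
    omega

theorem four {w : W} {a b : B} (h1 : cs.simple a * cs.simple b ≠ 1)
    (h2 : cs.simple a * cs.simple b * (cs.simple a * cs.simple b) ≠ 1)
    (h3 : cs.simple a * cs.simple b * (cs.simple a * cs.simple b) *
      (cs.simple a * cs.simple b) ≠ 1)
    (ha : cs.IsRightDescent w a) (hb : cs.IsRightDescent w b) :
    ∃ z, w = z * cs.wordProd [a, b, a, b] ∧ cs.length w = cs.length z + 4 := by
  have hA := cs.simple_mul_simple_self a
  have hB := cs.simple_mul_simple_self b
  have e1 : w = w * cs.simple a * cs.wordProd [a] := by simp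
  have l1 : cs.length w = cs.length (w * cs.simple a) + [a].length := by
    rw [cs.isRightDescent_iff] at ha; simp [ha]
  obtain ⟨y2, e2, l2⟩ := desc_step cs e1 l1 hb (by
    intro j hj
    simp only [List.length_singleton] at hj
    interval_cases j
    simpa using h1)
  obtain ⟨y3, e3, l3⟩ := desc_step cs e2 l2 ha (by
    intro j hj
    simp only [List.length_append, List.length_singleton] at hj
    interval_cases j
    · intro h
      simp only [List.cons_append, List.nil_append, List.eraseIdx_zero, List.tail_cons,
        wordProd_cons, wordProd_nil, mul_one] at h
      apply h2
      rw [← mul_assoc, h, hB]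
    · intro h
      simp only [List.cons_append, List.nil_append, List.eraseIdx_cons_succ, List.eraseIdx_zero, List.tail_cons,
        wordProd_cons, wordProd_nil, mul_one] at h
      apply h1
      have : cs.simple a * cs.simple b = (cs.simple a * cs.simple b * cs.simple a) * cs.simple a := by
        rw [mul_assoc _ _ (cs.simple a), hA, mul_one]
      rw [this, h, hA])
  obtain ⟨y4, e4, l4⟩ := desc_step cs e3 l3 hb (by
    intro j hj
    simp only [List.length_append, List.length_singleton] at hj
    interval_cases j
    · intro h
      simp only [List.cons_append, List.nil_append, List.eraseIdx_zero, List.tail_cons,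
        wordProd_cons, wordProd_nil, mul_one] at h
      apply h3
      have h' : cs.simple a * cs.simple b * (cs.simple a * cs.simple b) = cs.simple b * cs.simple a := by
        rw [← h]; group
      rw [h']
      simp [mul_assoc]
    · intro h
      simp only [List.cons_append, List.nil_append, List.eraseIdx_cons_succ, List.eraseIdx_zero, List.tail_cons,
        wordProd_cons, wordProd_nil, mul_one] at h
      apply h2
      rw [← hA, ← h]; group
    · intro h
      simp only [List.cons_append, List.nil_append, List.eraseIdx_cons_succ, List.eraseIdx_zero, List.tail_cons,
        wordProd_cons, wordProd_nil, mul_one] at h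
      apply h1
      have h' : cs.simple a * cs.simple b * (cs.simple a * cs.simple b) = cs.simple a * cs.simple b := by
        nth_rewrite 3 [← h]; group
      exact mul_eq_left.mp h')
  exact ⟨y4, by simpa using e4, by simpa using l4⟩

/-- All products `st` of distinct generators have order at least four. -/
def Big : Prop := ∀ a b : B, a ≠ b → cs.simple a * cs.simple b ≠ 1 ∧
    cs.simple a * cs.simple b * (cs.simple a * cs.simple b) ≠ 1 ∧
    cs.simple a * cs.simple b * (cs.simple a * cs.simple b) * (cs.simple a * cs.simple b) ≠ 1

variable {cs}

theorem desc_chain (H : Big cs) {w : W} {a b : B} (hab : a ≠ b)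
    (ha : cs.IsRightDescent w a) (hb : cs.IsRightDescent w b) :
    cs.IsRightDescent (w * cs.simple a) b ∧
    cs.IsRightDescent (w * cs.simple a * cs.simple b) a ∧
    cs.IsRightDescent (w * cs.simple a * cs.simple b * cs.simple a) b := by
  obtain ⟨h1, h2, h3⟩ := H b a hab.symm
  obtain ⟨z, hz, hl⟩ := four cs h1 h2 h3 hb ha
  have hA := cs.simple_mul_simple_self a
  have hB := cs.simple_mul_simple_self b
  have f4 : w * cs.simple a * cs.simple b * cs.simple a * cs.simple b = z := by
    rw [hz]; simp [wordProd_cons, mul_assoc]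
  have s1 := cs.length_mul_simple w a
  have s2 := cs.length_mul_simple (w * cs.simple a) b
  have s3 := cs.length_mul_simple (w * cs.simple a * cs.simple b) a
  have s4 := cs.length_mul_simple (w * cs.simple a * cs.simple b * cs.simple a) b
  rw [f4] at s4
  unfold IsRightDescent
  rw [f4]
  omega

theorem no_P (H : Big cs) (N : ℕ) : ∀ (w : W) (a b c : B), cs.length w = N → a ≠ b → b ≠ c →
    a ≠ c → cs.IsRightDescent w a → cs.IsRightDescent w b →
    cs.IsRightDescent (w * cs.simple a) c → False := by
  induction N with
  | zero =>
    intro w a b c hN _ _ _ ha _ _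
    unfold IsRightDescent at ha
    omega
  | succ N ih =>
    intro w a b c hN hab hbc hac ha hb hc
    obtain ⟨d1, d2, -⟩ := desc_chain H hab ha hb
    refine ih (w * cs.simple a) b c a ?_ hbc hac.symm hab.symm d1 hc d2
    rw [cs.isRightDescent_iff] at ha
    omega

theorem no_three (H : Big cs) {w : W} {a b c : B} (hab : a ≠ b) (hbc : b ≠ c) (hac : a ≠ c)
    (ha : cs.IsRightDescent w a) (hb : cs.IsRightDescent w b) (hc : cs.IsRightDescent w c) :
    False :=
  no_P H _ w a b c rfl hab hbc hac ha hb (desc_chain H hac ha hc).1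

theorem single (H : Big cs) {v : W} {s t r : B} (hst : s ≠ t)
    (hs : cs.IsRightDescent v s) (ht : cs.IsRightDescent v t)
    (hr : cs.IsRightDescent (v * cs.simple s) r) : r = t := by
  by_contra hrt
  have hrs : r ≠ s := by
    rintro rfl
    exact cs.isRightDescent_iff_not_isRightDescent_mul.mp hs hr
  obtain ⟨d1, d2, -⟩ := desc_chain H hst hs ht
  exact no_P H _ _ t r s rfl (Ne.symm hrt) hrs hst.symm d1 hr d2

theorem inj (H : Big cs) {v v' : W} {s t s' t' : B} (hst : s ≠ t) (hst' : s' ≠ t')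
    (hs : cs.IsRightDescent v s) (ht : cs.IsRightDescent v t)
    (hs' : cs.IsRightDescent v' s') (ht' : cs.IsRightDescent v' t')
    (h : v * cs.simple s = v' * cs.simple s') : v = v' := by
  obtain ⟨d1, d2, d3⟩ := desc_chain H hst hs ht
  obtain ⟨d1', d2', -⟩ := desc_chain H hst' hs' ht'
  rw [← h] at d1' d2'
  have htt : t' = t := single H hst hs ht d1'
  subst htt
  by_cases hss : s = s'
  · subst hss
    exact mul_right_cancel h
  · exact (no_P H _ _ s s' t' rfl hss hst' hst d2 d2' d3).elim

end dihedral

section counting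

variable [Fintype B] {cs : CoxeterSystem M W}

theorem finite_level (cs : CoxeterSystem M W) (i : ℕ) : {w : W | cs.length w = i}.Finite := by
  refine ((List.finite_length_eq B i).image cs.wordProd).subset ?_
  intro w hw
  obtain ⟨ω, hω, rfl⟩ := cs.exists_isReduced w
  exact ⟨ω, by rw [← Set.mem_ofPred.mp hw, hω.eq]; simp, rfl⟩

/-- Elements of length `i`. -/
noncomputable def level (cs : CoxeterSystem M W) (i : ℕ) : Finset W := (finite_level cs i).toFinset

theorem mem_level {i : ℕ} {w : W} : w ∈ level cs i ↔ cs.length w = i := by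
  simp [level]

open Classical in
/-- The right descent set. -/
noncomputable def D (cs : CoxeterSystem M W) (w : W) : Finset B :=
  Finset.univ.filter (fun b => cs.IsRightDescent w b)

theorem mem_D {w : W} {b : B} : b ∈ D cs w ↔ cs.IsRightDescent w b := by simp [D]

theorem D_le_two (H : Big cs) (w : W) : (D cs w).card ≤ 2 := by
  by_contra! h
  obtain ⟨a, b, c, ha, hb, hc, hab, hac, hbc⟩ := Finset.two_lt_card_iff.mp h
  rw [mem_D] at ha hb hc
  exact no_three H hab hbc hac ha hb hc

open Classical in
theorem edges (i : ℕ) : ∑ w ∈ level cs i, ((D cs w)ᶜ).card =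
    ∑ v ∈ level cs (i + 1), (D cs v).card := by
  rw [← Finset.card_sigma, ← Finset.card_sigma]
  refine Finset.card_bij' (fun p _ => ⟨p.1 * cs.simple p.2, p.2⟩)
    (fun p _ => ⟨p.1 * cs.simple p.2, p.2⟩) ?_ ?_ ?_ ?_
  · rintro ⟨w, r⟩ h
    simp only [Finset.mem_sigma, mem_level, Finset.mem_compl, mem_D] at h ⊢
    rw [cs.not_isRightDescent_iff] at h
    rw [cs.isRightDescent_iff, cs.simple_mul_simple_cancel_right]
    omega
  · rintro ⟨w, r⟩ h
    simp only [Finset.mem_sigma, mem_level, Finset.mem_compl, mem_D] at h ⊢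
    rw [cs.isRightDescent_iff] at h
    rw [cs.not_isRightDescent_iff, cs.simple_mul_simple_cancel_right]
    omega
  · rintro ⟨w, r⟩ h
    simp
  · rintro ⟨w, r⟩ h
    simp

theorem b_le_a [Nonempty B] (H : Big cs) (i : ℕ) :
    ((level cs (i + 1)).filter (fun v => (D cs v).card = 2)).card ≤
    ((level cs i).filter (fun v => (D cs v).card = 1)).card := by
  classical
  have key : ∀ v : W, (D cs v).card = 2 → ∃ s t : B, s ≠ t ∧
      cs.IsRightDescent v s ∧ cs.IsRightDescent v t := by
    intro v hv
    obtain ⟨s, t, hst, h⟩ := Finset.card_eq_two.mp hv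
    refine ⟨s, t, hst, ?_, ?_⟩ <;> rw [← mem_D, h] <;> simp
  choose! s t hst hs ht using key
  refine Finset.card_le_card_of_injOn (fun v => v * cs.simple (s v)) ?_ ?_
  · intro v hv
    simp only [Finset.coe_filter, Set.mem_ofPred_eq, mem_level] at hv ⊢
    obtain ⟨h1, h2⟩ := hv
    constructor
    · have := cs.isRightDescent_iff.mp (hs v h2)
      omega
    · refine Finset.card_eq_one.mpr ⟨t v, ?_⟩
      ext r
      rw [mem_D, Finset.mem_singleton]
      constructor
      · exact single H (hst v h2) (hs v h2) (ht v h2)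
      · rintro rfl
        exact (desc_chain H (hst v h2) (hs v h2) (ht v h2)).1
  · intro v hv v' hv' h
    simp only [Finset.coe_filter, Set.mem_ofPred_eq, mem_level] at hv hv'
    exact inj H (hst v hv.2) (hst v' hv'.2) (hs v hv.2) (ht v hv.2) (hs v' hv'.2) (ht v' hv'.2) h

theorem main (H : Big cs) (hB : 2 ≤ Fintype.card B) (i : ℕ) :
    (Fintype.card B - 2) * (level cs i).card ≤ (level cs (i + 1)).card := by
  classical
  have h1 : ∑ v ∈ level cs (i + 1), (D cs v).card ≤ (level cs (i + 1)).card +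
      ((level cs (i + 1)).filter (fun v => (D cs v).card = 2)).card := by
    rw [Finset.card_filter, Finset.card_eq_sum_ones, ← Finset.sum_add_distrib]
    refine Finset.sum_le_sum fun v _ => ?_
    have := D_le_two H v
    split_ifs <;> omega
  have h2 : (Fintype.card B - 2) * (level cs i).card +
      ((level cs i).filter (fun v => (D cs v).card = 1)).card ≤
      ∑ w ∈ level cs i, ((D cs w)ᶜ).card := by
    rw [Finset.card_filter, Finset.card_eq_sum_ones, Finset.mul_sum, ← Finset.sum_add_distrib]
    refine Finset.sum_le_sum fun v _ => ?_
    have := D_le_two H v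
    have h4 := Finset.card_add_card_compl (D cs v)
    split_ifs <;> omega
  haveI : Nonempty B := Fintype.card_pos_iff.mp (by omega)
  have h3 := b_le_a H i
  rw [edges] at h2
  omega

end counting

end CoxLB

/-- Let `(W, S)` be a Coxeter system of finite rank `n ≥ 3` such that there exists `m ≥ 4`
with `m s t = m` for all `s ≠ t` in `S`. Let `c i` be the number of elements of length `i`.
Then for every `i > m` one has `(n - 2) * c i ≤ c (i+1)`. -/
theorem c_lower_bound
    {B : Type*} [Fintype B] {W : Type*} [Group W] {M : CoxeterMatrix B}
    (cs : CoxeterSystem M W) (n : ℕ) (hn : Fintype.card B = n) (hn3 : 3 ≤ n)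
    (m : ℕ) (hm : 4 ≤ m)
    (hM : ∀ s t : B, s ≠ t → orderOf (cs.simple s * cs.simple t) = m)
    (c : ℕ → ℕ)
    (hc : ∀ i, c i = Nat.card {w : W // cs.length w = i})
    (i : ℕ) (hi : m < i) :
    (n - 2) * c i ≤ c (i + 1) := by
  have H : CoxLB.Big cs := by
    intro a b hab
    have ho := hM a b hab
    have hne : ∀ k : ℕ, k ≠ 0 → k < m → (cs.simple a * cs.simple b) ^ k ≠ 1 := by
      intro k hk hkm
      exact pow_ne_one_of_lt_orderOf hk (by omega)
    refine ⟨?_, ?_, ?_⟩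
    · simpa using hne 1 (by omega) (by omega)
    · simpa [pow_succ] using hne 2 (by omega) (by omega)
    · simpa [pow_succ] using hne 3 (by omega) (by omega)
  have hcard : ∀ j, c j = (CoxLB.level cs j).card := by
    intro j
    rw [hc, CoxLB.level, ← Set.ncard_eq_toFinset_card _ (CoxLB.finite_level cs j)]
    rfl
  rw [hcard, hcard, ← hn]
  exact CoxLB.main H (by omega) i
end

section
/- Let (W,S) be a Coxeter system of finite rank n ≥ 3 such that there exists m ≥ 4 with m_{st} = m for all s ≠ t ∈ S. Then for every natural number i > m one has (n-2)·d_i ≤ d_{i+1}. -/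
section Aux

open Finset

variable {B : Type*} {W : Type*} [Group W] {M : CoxeterMatrix B} (cs : CoxeterSystem M W)

open Classical in
/-- The action of a simple reflection on `W × ZMod 2`. -/
noncomputable def fAct (i : B) : Function.End (W × ZMod 2) :=
  fun p => (cs.simple i * p.1 * cs.simple i, p.2 + if p.1 = cs.simple i then 1 else 0)

lemma conj_pow_aux (a b : W) (ha : a * a = 1) (hb : b * b = 1) (k : ℕ) :
    (a * b) ^ k * b * (a * b) ^ k = b := by
  induction k with
  | zero => simp
  | succ k ih =>
    have h1 : (a * b) * b * (a * b) = b := by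
      calc (a * b) * b * (a * b) = a * (b * b) * a * b := by simp only [mul_assoc]
        _ = b := by rw [hb, mul_one, ha, one_mul]
    calc (a * b) ^ (k + 1) * b * (a * b) ^ (k + 1)
        = (a * b) ^ k * ((a * b) * b * (a * b)) * (a * b) ^ k := by
          nth_rw 2 [pow_succ']
          rw [pow_succ]
          simp only [mul_assoc]
      _ = b := by rw [h1, ih]

lemma conj_eq_iff (a b t : W) (ha : a * a = 1) (hb : b * b = 1) (k : ℕ) :
    ((a * b) ^ k * t * ((a * b) ^ k)⁻¹ = b) ↔ t = b * (a * b) ^ (2 * k) := by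
  have hc := conj_pow_aux a b ha hb k
  rw [mul_inv_eq_iff_eq_mul, ← eq_inv_mul_iff_mul_eq]
  have : ((a * b) ^ k)⁻¹ * (b * (a * b) ^ k) = b * (a * b) ^ (2 * k) := by
    rw [inv_mul_eq_iff_eq_mul, two_mul, pow_add, ← mul_assoc, ← mul_assoc, hc]
  rw [this]

open Classical in
lemma fAct_pow (i j : B) (k : ℕ) (t : W) (e : ZMod 2) :
    ((fAct cs i * fAct cs j) ^ k) (t, e) =
      ((cs.simple i * cs.simple j) ^ k * t * ((cs.simple i * cs.simple j) ^ k)⁻¹,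
        e + ∑ l ∈ range (2 * k),
          if t = cs.simple j * (cs.simple i * cs.simple j) ^ l then 1 else 0) := by
  set a := cs.simple i with ha
  set b := cs.simple j with hb
  have haa : a * a = 1 := cs.simple_mul_simple_self i
  have hbb : b * b = 1 := cs.simple_mul_simple_self j
  have hai : a⁻¹ = a := cs.inv_simple i
  have hbi : b⁻¹ = b := cs.inv_simple j
  induction k with
  | zero => simp; rfl
  | succ k ih =>
    rw [pow_succ']
    change (fAct cs i * fAct cs j) (((fAct cs i * fAct cs j) ^ k) (t, e)) = _
    rw [ih]
    change fAct cs i (fAct cs j _) = _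
    have hc := conj_pow_aux a b haa hbb k
    simp only [fAct, ← ha, ← hb]
    have h1 := conj_eq_iff a b t haa hbb k
    have h2 : (b * ((a * b) ^ k * t * ((a * b) ^ k)⁻¹) * b = a) ↔
        t = b * (a * b) ^ (2 * k + 1) := by
      have e1 : ∀ y : W, b * y * b = a ↔ y = b * (a * b) := by
        intro y
        constructor
        · intro h
          rw [← h]
          simp only [mul_assoc, hbb, mul_one]
          rw [← mul_assoc, hbb, one_mul]
        · intro h
          rw [h]
          simp only [mul_assoc, hbb, mul_one]
          rw [← mul_assoc, hbb, one_mul]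
      rw [e1, mul_inv_eq_iff_eq_mul, ← eq_inv_mul_iff_mul_eq]
      have : ((a * b) ^ k)⁻¹ * (b * (a * b) * (a * b) ^ k) = b * (a * b) ^ (2 * k + 1) := by
        rw [inv_mul_eq_iff_eq_mul]
        calc b * (a * b) * (a * b) ^ k = b * (a * b) ^ (k + 1) := by
              rw [pow_succ', mul_assoc]
          _ = ((a * b) ^ k * b * (a * b) ^ k) * (a * b) ^ (k + 1) := by rw [hc]
          _ = _ := by
            rw [show 2 * k + 1 = k + (k + 1) by ring, pow_add _ k (k + 1)]
            simp only [mul_assoc]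
      rw [this]
    rw [show 2 * (k + 1) = 2 * k + 1 + 1 by ring, sum_range_succ, sum_range_succ]
    simp only [h1, h2]
    ext
    · simp only [pow_succ', mul_inv_rev, hai, hbi, mul_assoc]
    · simp only [add_assoc]

lemma fAct_liftable : M.IsLiftable (fAct cs) := by
  classical
  intro i j
  funext ⟨t, e⟩
  rw [fAct_pow, cs.simple_mul_simple_pow, two_mul, sum_range_add]
  simp only [pow_add, cs.simple_mul_simple_pow, one_mul, inv_one, mul_one, CharTwo.add_self_eq_zero,
    add_zero]
  rfl

/-- The reflection action. -/
noncomputable def phi : W →* Function.End (W × ZMod 2) := cs.lift ⟨fAct cs, fAct_liftable cs⟩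

/-- The parity of inversions. -/
noncomputable def NN (w t : W) : ZMod 2 := (phi cs w (t, 0)).2

open Classical in
lemma phi_simple (i : B) (t : W) (e : ZMod 2) : phi cs (cs.simple i) (t, e) =
    (cs.simple i * t * cs.simple i, e + if t = cs.simple i then 1 else 0) := by
  rw [phi, cs.lift_apply_simple]; rfl

lemma phi_apply (w t : W) (e : ZMod 2) : phi cs w (t, e) = (w * t * w⁻¹, e + NN cs w t) := by
  classical
  suffices ∀ w : W, ∀ t, ∃ c, ∀ e, phi cs w (t, e) = (w * t * w⁻¹, e + c) by
    obtain ⟨c, hc⟩ := this w t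
    rw [NN, hc, hc]; simp
  intro w
  induction w using cs.simple_induction_left with
  | one => intro t; exact ⟨0, fun e => by simp; rfl⟩
  | mul_simple_left w i ih =>
    intro t
    obtain ⟨c, hc⟩ := ih t
    refine ⟨c + if w * t * w⁻¹ = cs.simple i then 1 else 0, fun e => ?_⟩
    rw [map_mul]
    change phi cs (cs.simple i) (phi cs w (t, e)) = _
    rw [hc, phi_simple]
    simp [mul_assoc, add_assoc]

lemma NN_mul (u v t : W) : NN cs (u * v) t = NN cs v t + NN cs u (v * t * v⁻¹) := by
  have h : phi cs (u * v) (t, 0) = phi cs u (phi cs v (t, 0)) := by rw [map_mul]; rfl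
  rw [phi_apply, phi_apply, phi_apply] at h
  have := congrArg Prod.snd h
  simpa using this

lemma NN_one (t : W) : NN cs 1 t = 0 := by
  rw [NN, map_one]; rfl

open Classical in
lemma NN_simple (i : B) (t : W) : NN cs (cs.simple i) t = if t = cs.simple i then 1 else 0 := by
  rw [NN, phi_simple]; simp

lemma mem_ris (ω : List B) (t : W) (h : NN cs (cs.wordProd ω) t ≠ 0) :
    t ∈ cs.rightInvSeq ω := by
  classical
  induction ω with
  | nil => simp [NN_one] at h
  | cons i ω ih =>
    rw [cs.wordProd_cons, NN_mul, NN_simple] at h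
    rw [CoxeterSystem.rightInvSeq, List.mem_cons]
    by_cases h0 : NN cs (cs.wordProd ω) t = 0
    · left
      rw [h0] at h
      by_contra h1
      apply h
      rw [if_neg, add_zero]
      intro h2
      apply h1
      rw [← h2]; group
    · exact Or.inr (ih h0)

lemma length_lt_of_NN (w t : W) (h : NN cs w t ≠ 0) : cs.length (w * t) < cs.length w := by
  obtain ⟨ω, hω, rfl⟩ := cs.exists_isReduced w
  exact (cs.isRightInversion_of_mem_rightInvSeq hω (mem_ris cs ω t h)).2

lemma desc_iff (w : W) (i : B) :
    cs.length (w * cs.simple i) < cs.length w ↔ NN cs w (cs.simple i) ≠ 0 := by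
  refine ⟨fun h h0 => ?_, length_lt_of_NN cs w _⟩
  have : NN cs (w * cs.simple i) (cs.simple i) ≠ 0 := by
    rw [NN_mul, NN_simple]; simp [h0]
  have := length_lt_of_NN cs _ _ this
  simp at this
  omega

open Classical in
lemma NN_pow (i j : B) (k : ℕ) (t : W) :
    NN cs ((cs.simple i * cs.simple j) ^ k) t = ∑ l ∈ range (2 * k),
      if t = cs.simple j * (cs.simple i * cs.simple j) ^ l then 1 else 0 := by
  have h : phi cs ((cs.simple i * cs.simple j) ^ k) = (fAct cs i * fAct cs j) ^ k := by
    rw [map_pow, map_mul, phi, cs.lift_apply_simple, cs.lift_apply_simple]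
  rw [NN, h, fAct_pow]
  simp

open Classical in
lemma NN_pow' (i j : B) (k : ℕ) (t : W) :
    NN cs (cs.simple j * (cs.simple i * cs.simple j) ^ k) t = ∑ l ∈ range (2 * k + 1),
      if t = cs.simple j * (cs.simple i * cs.simple j) ^ l then 1 else 0 := by
  rw [NN_mul, NN_pow, NN_simple, sum_range_succ]
  simp only [conj_eq_iff _ _ t (cs.simple_mul_simple_self i) (cs.simple_mul_simple_self j) k]

open Classical in
lemma sum_pow_eq (b c : W) (p q : ℕ) (hp : p < orderOf c) (hq : q ≤ orderOf c) :
    (∑ l ∈ range q, if b * c ^ p = b * c ^ l then (1 : ZMod 2) else 0) =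
      if p < q then 1 else 0 := by
  have : ∀ l ∈ range q, (if b * c ^ p = b * c ^ l then (1 : ZMod 2) else 0) =
      if p = l then 1 else 0 := by
    intro l hl
    have hl' : l < orderOf c := lt_of_lt_of_le (mem_range.1 hl) hq
    have : b * c ^ p = b * c ^ l ↔ p = l := by
      rw [mul_right_inj]
      exact ⟨fun h => pow_injOn_Iio_orderOf hp hl' h, fun h => by rw [h]⟩
    simp only [this]
  rw [sum_congr rfl this]
  simp

/-- Commutation of a power past an involution. -/
lemma zpow_comm_aux (a b : W) (ha : a * a = 1) (hb : b * b = 1) (k : ℤ) :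
    (a * b) ^ k * b = b * (a * b) ^ (-k) := by
  have hbi : b⁻¹ = b := inv_eq_of_mul_eq_one_left hb
  have hai : a⁻¹ = a := inv_eq_of_mul_eq_one_left ha
  have h1 : b * (a * b) * b⁻¹ = (a * b)⁻¹ := by
    rw [mul_inv_rev, hbi, hai]; simp [mul_assoc, hb]
  have h2 : b * (a * b) ^ (-k) * b⁻¹ = (a * b) ^ k := by
    rw [← conj_zpow, h1, inv_zpow, zpow_neg, inv_inv]
  rw [← h2]; simp [mul_assoc]

lemma dihedral (i j : B) (u : W) (h2 : 2 ≤ orderOf (cs.simple i * cs.simple j))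
    (hi : NN cs u (cs.simple i) ≠ 0) (hj : NN cs u (cs.simple j) ≠ 0) (l : ℤ) :
    NN cs u (cs.simple j * (cs.simple i * cs.simple j) ^ l) ≠ 0 := by
  classical
  have hs := fun k t => NN_pow cs i j k t
  have hs' := fun k t => NN_pow' cs i j k t
  set a := cs.simple i with ha
  set b := cs.simple j with hb
  set c := a * b with hcdef
  have haa : a * a = 1 := cs.simple_mul_simple_self i
  have hbb : b * b = 1 := cs.simple_mul_simple_self j
  have hai : a⁻¹ = a := cs.inv_simple i
  have hbi : b⁻¹ = b := cs.inv_simple j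
  have hcomm : ∀ k : ℤ, c ^ k * b = b * c ^ (-k) := zpow_comm_aux a b haa hbb
  have hcomm' : ∀ (k : ℤ) (y : W), c ^ k * (b * y) = b * (c ^ (-k) * y) := fun k y => by
    rw [← mul_assoc, hcomm, mul_assoc]
  have hbb' : ∀ y : W, b * (b * y) = y := fun y => by rw [← mul_assoc, hbb, one_mul]
  have hzz : ∀ (k k' : ℤ), c ^ k * c ^ k' = c ^ (k + k') := fun k k' => (zpow_add c k k').symm
  set m := orderOf c with hmdef
  -- a minimal coset representative
  let D : Set W := {x | ∃ k : ℤ, x = c ^ k ∨ x = b * c ^ k}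
  have hD : D.Nonempty := ⟨1, 0, Or.inl (by simp)⟩
  obtain ⟨x, ⟨k, hxk⟩, hxmin⟩ : ∃ x ∈ D, ∀ y ∈ D,
      cs.length (u * x⁻¹) ≤ cs.length (u * y⁻¹) := by
    obtain ⟨x, hx, h⟩ := exists_minimalFor_of_wellFoundedLT (· ∈ D)
      (fun x => cs.length (u * x⁻¹)) hD
    exact ⟨x, hx, fun y hy => by
      rcases le_total (cs.length (u * x⁻¹)) (cs.length (u * y⁻¹)) with h' | h'
      · exact h'
      · exact h hy h'⟩
  have hNx : ∀ p : ℤ, NN cs u (b * c ^ p) = NN cs x (b * c ^ p) := by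
    intro p
    have e : u = (u * x⁻¹) * x := by group
    have e3 : NN cs u (b * c ^ p) =
        NN cs x (b * c ^ p) + NN cs (u * x⁻¹) (x * (b * c ^ p) * x⁻¹) := by
      rw [← NN_mul, ← e]
    rw [e3]
    suffices NN cs (u * x⁻¹) (x * (b * c ^ p) * x⁻¹) = 0 by rw [this, add_zero]
    by_contra hne
    have hlt := length_lt_of_NN cs _ _ hne
    have hy : x * (b * c ^ p)⁻¹ ∈ D := by
      rw [mul_inv_rev, hbi, ← zpow_neg]
      rcases hxk with rfl | rfl
      · exact ⟨-k + p, Or.inr (by simp only [hcomm, hcomm', hzz, mul_assoc, neg_add, neg_neg])⟩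
      · exact ⟨-k + p, Or.inl (by
          simp only [hcomm, hcomm', hzz, hbb', mul_assoc, neg_add, neg_neg])⟩
    have := hxmin _ hy
    have e2 : u * x⁻¹ * (x * (b * c ^ p) * x⁻¹) = u * (x * (b * c ^ p)⁻¹)⁻¹ := by group
    rw [e2] at hlt
    omega
  -- the length of the alternating word
  have hm0 : (0 : ℤ) < m := by omega
  have hmod : ∀ p : ℤ, ∃ q : ℕ, q < m ∧ c ^ p = c ^ q := by
    intro p
    refine ⟨(p % m).toNat, ?_, ?_⟩
    · have := Int.emod_lt_of_pos p hm0
      have := Int.emod_nonneg p hm0.ne'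
      omega
    · have := Int.emod_nonneg p hm0.ne'
      rw [← zpow_natCast, Int.toNat_of_nonneg this, hmdef, zpow_mod_orderOf]
  obtain ⟨L, hL, hNL⟩ : ∃ L : ℕ, L < 2 * m ∧ ∀ t, NN cs x t =
      ∑ l ∈ range L, if t = b * c ^ l then 1 else 0 := by
    obtain ⟨q, hq, hcq⟩ := hmod k
    rw [hcq] at hxk
    rcases hxk with rfl | rfl
    · exact ⟨2 * q, by omega, hs q⟩
    · exact ⟨2 * q + 1, by omega, hs' q⟩
  have hNN : ∀ p : ℕ, p < m → NN cs u (b * c ^ p) =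
      ∑ l ∈ range L, if b * c ^ p = b * c ^ l then 1 else 0 := by
    intro p hp
    have := hNx p
    rw [zpow_natCast] at this
    rw [this, hNL]
  have hb0 : b = b * c ^ 0 := by simp
  have ham : a = b * c ^ (m - 1) := by
    have h1 : c ^ (m - 1) * c = 1 := by
      rw [← pow_succ, Nat.sub_add_cancel (by omega), hmdef, pow_orderOf_eq_one]
    rw [eq_inv_of_mul_eq_one_left h1, hcdef, mul_inv_rev, hbi, hai, hbb']
  rw [ham, hNN _ (by omega)] at hi
  rw [hb0, hNN _ (by omega)] at hj
  have hLm : m ≤ L := by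
    by_contra hlt
    rw [sum_pow_eq b c _ _ (by omega) (by omega), if_neg (by omega)] at hi
    exact hi rfl
  obtain ⟨q, rfl⟩ := Nat.exists_eq_add_of_le hLm
  have hcm : ∀ x, c ^ (m + x) = c ^ x := fun x => by
    rw [pow_add, hmdef, pow_orderOf_eq_one, one_mul]
  have hsplit : ∀ p, p < m → NN cs u (b * c ^ p) = 1 + if p < q then 1 else 0 := by
    intro p hp
    rw [hNN p hp, sum_range_add]
    simp only [hcm]
    rw [sum_pow_eq b c _ _ hp le_rfl, sum_pow_eq b c _ _ hp (by omega), if_pos hp]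
  have hq : q = 0 := by
    by_contra hq
    rw [← hNN 0 (by omega), hsplit 0 (by omega), if_pos (by omega)] at hj
    exact hj (by decide)
  obtain ⟨p, hp, hcp⟩ := hmod l
  rw [hcp, hsplit p hp, hq]
  simp

/-- The three consequences of having two descents `i`, `j`, when the order of `s_i s_j` is at
least four. -/
lemma two_desc (i j : B) (u : W) (h4 : 4 ≤ orderOf (cs.simple i * cs.simple j))
    (hi : NN cs u (cs.simple i) ≠ 0) (hj : NN cs u (cs.simple j) ≠ 0) :
    NN cs (u * cs.simple i) (cs.simple j) ≠ 0 ∧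
    NN cs (u * cs.simple i * cs.simple j) (cs.simple i) ≠ 0 ∧
    NN cs (u * cs.simple i * cs.simple j * cs.simple i) (cs.simple j) ≠ 0 := by
  classical
  have hd := dihedral cs i j u (by omega) hi hj
  have hpow : ∀ k : ℕ, 0 < k → k < 4 → (cs.simple i * cs.simple j) ^ k ≠ 1 := by
    intro k hk hk4 h
    have := Nat.le_of_dvd hk (orderOf_dvd_of_pow_eq_one h)
    omega
  have hsi := NN_simple cs i
  have hsj := NN_simple cs j
  set a := cs.simple i with ha
  set b := cs.simple j with hb
  have haa : a * a = 1 := cs.simple_mul_simple_self i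
  have hbb : b * b = 1 := cs.simple_mul_simple_self j
  have haa' : ∀ y, a * (a * y) = y := fun y => by rw [← mul_assoc, haa, one_mul]
  have hbb' : ∀ y, b * (b * y) = y := fun y => by rw [← mul_assoc, hbb, one_mul]
  have hai : a⁻¹ = a := cs.inv_simple i
  have hbi : b⁻¹ = b := cs.inv_simple j
  have n1 : b ≠ a := fun h => hpow 1 (by omega) (by omega) (by rw [pow_one, h, haa])
  have n2 : b * (a * b) ≠ a := fun h => hpow 2 (by omega) (by omega) (by
    rw [pow_two, mul_assoc, h, haa])
  have n2' : a * (b * a) ≠ b := fun h => hpow 2 (by omega) (by omega) (by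
    rw [pow_two, ← mul_assoc, mul_assoc a b a, h, hbb])
  have n3 : b * (a * (b * (a * b))) ≠ a := fun h => hpow 3 (by omega) (by omega) (by
    rw [pow_three]; simp only [mul_assoc]; rw [h, haa])
  have d2 : NN cs u (a * (b * a)) ≠ 0 := by
    have := hd (-2)
    rwa [show b * (a * b) ^ (-2 : ℤ) = a * (b * a) by
      rw [zpow_neg, zpow_ofNat, pow_two]
      simp only [mul_inv_rev, hai, hbi, mul_assoc, hbb']] at this
  have d3 : NN cs u (a * (b * (a * (b * a)))) ≠ 0 := by
    have := hd (-3)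
    rwa [show b * (a * b) ^ (-3 : ℤ) = a * (b * (a * (b * a))) by
      rw [zpow_neg, zpow_ofNat, pow_three]
      simp only [mul_inv_rev, hai, hbi, mul_assoc, hbb']] at this
  have d4 : NN cs u (a * (b * (a * (b * (a * (b * a)))))) ≠ 0 := by
    have := hd (-4)
    rwa [show b * (a * b) ^ (-4 : ℤ) = a * (b * (a * (b * (a * (b * a))))) by
      rw [zpow_neg, zpow_ofNat, pow_succ, pow_three]
      simp only [mul_inv_rev, hai, hbi, mul_assoc, hbb']] at this
  refine ⟨?_, ?_, ?_⟩
  · rw [NN_mul, hsi, if_neg n1, zero_add, hai, mul_assoc]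
    exact d2
  · rw [NN_mul, hsj, if_neg n1.symm, zero_add, NN_mul, hsi, hai, hbi]
    simp only [mul_assoc]
    rw [if_neg n2, zero_add]
    exact d3
  · rw [NN_mul, hsi, if_neg n1, zero_add, NN_mul, hsj, NN_mul, hsi, hai, hbi]
    simp only [mul_assoc]
    rw [if_neg n2', zero_add, if_neg n3, zero_add]
    exact d4

/-- The infinite descent. -/
lemma no_descent {m : ℕ} (hm : 4 ≤ m)
    (hM : ∀ s t : B, s ≠ t → orderOf (cs.simple s * cs.simple t) = m) (N : ℕ) :
    ∀ (u : W) (t r s : B), cs.length u ≤ N → t ≠ r → r ≠ s → s ≠ t →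
      NN cs u (cs.simple t) ≠ 0 → NN cs u (cs.simple r) ≠ 0 →
      NN cs (u * cs.simple t) (cs.simple s) ≠ 0 → False := by
  induction N with
  | zero =>
    intro u t r s hu _ _ _ ht _ _
    have := length_lt_of_NN cs _ _ ht
    omega
  | succ N ih =>
    intro u t r s hu htr hrs hst ht hr hs
    have h := two_desc cs t r u (by rw [hM t r htr]; exact hm) ht hr
    have := length_lt_of_NN cs _ _ ht
    exact ih (u * cs.simple t) r s t (by omega) hrs hst htr h.1 hs h.2.1

lemma bad_unique {m : ℕ} (hm : 4 ≤ m)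
    (hM : ∀ s t : B, s ≠ t → orderOf (cs.simple s * cs.simple t) = m)
    (w : W) (s : B) (hs' : ∀ x, NN cs w (cs.simple x) ≠ 0 → x = s)
    (t r : B) (hts : t ≠ s) (hrs : r ≠ s)
    (ht : ¬ ∃! x : B, NN cs (w * cs.simple t) (cs.simple x) ≠ 0)
    (hr : ¬ ∃! x : B, NN cs (w * cs.simple r) (cs.simple x) ≠ 0) : t = r := by
  have key : ∀ t : B, t ≠ s → (¬ ∃! x : B, NN cs (w * cs.simple t) (cs.simple x) ≠ 0) →
      NN cs (w * cs.simple s) (cs.simple t) ≠ 0 ∧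
      NN cs (w * cs.simple s * cs.simple t) (cs.simple s) ≠ 0 := by
    intro t hts ht
    have h1 : NN cs (w * cs.simple t) (cs.simple t) ≠ 0 := by
      rw [← desc_iff, cs.simple_mul_simple_cancel_right]
      by_contra hcon
      have : cs.length (w * cs.simple t) < cs.length w := by
        have := cs.length_mul_simple_ne w t
        omega
      exact hts (hs' t ((desc_iff cs w t).1 this))
    obtain ⟨x, hx, hxt⟩ : ∃ x, NN cs (w * cs.simple t) (cs.simple x) ≠ 0 ∧ x ≠ t := by
      by_contra hcon
      push Not at hcon
      exact ht ⟨t, h1, fun y hy => hcon y hy⟩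
    have h2 := two_desc cs t x _ (by rw [hM t x hxt.symm]; exact hm) h1 hx
    simp only [cs.simple_mul_simple_cancel_right] at h2
    obtain rfl := hs' x h2.1
    exact h2.2
  by_contra htr
  have kt := key t hts ht
  have kr := key r hrs hr
  exact no_descent cs hm hM _ (w * cs.simple s) t r s le_rfl htr hrs hts.symm kt.1 kr.1 kt.2

end Aux

/-- Let `(W, S)` be a Coxeter system of finite rank `n ≥ 3` such that there exists `m ≥ 4`
with `m s t = m` for all `s ≠ t` in `S`. Let `d i` be the number of elements of length `i`
with exactly one right descent. Then for every `i > m` one has `(n - 2) * d i ≤ d (i+1)`. -/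
theorem d_lower_bound
    {B : Type*} [Fintype B] {W : Type*} [Group W] {M : CoxeterMatrix B}
    (cs : CoxeterSystem M W) (n : ℕ) (hn : Fintype.card B = n) (hn3 : 3 ≤ n)
    (m : ℕ) (hm : 4 ≤ m)
    (hM : ∀ s t : B, s ≠ t → orderOf (cs.simple s * cs.simple t) = m)
    (d : ℕ → ℕ)
    (hd : ∀ i, d i = Nat.card {w : W // cs.length w = i ∧
      ∃! s : B, cs.length (w * cs.simple s) < cs.length w})
    (i : ℕ) (hi : m < i) :
    (n - 2) * d i ≤ d (i + 1) := by
  classical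
  have hfin : ∀ i, Set.Finite {w : W | cs.length w = i ∧
      ∃! s : B, cs.length (w * cs.simple s) < cs.length w} := by
    intro i
    refine ((List.finite_length_eq B i).image cs.wordProd).subset ?_
    rintro w ⟨hw, -⟩
    obtain ⟨ω, hω, rfl⟩ := cs.exists_isReduced w
    exact ⟨ω, by rw [← hw]; exact hω.symm, rfl⟩
  have hd' : ∀ i, d i = (hfin i).toFinset.card := by
    intro i
    rw [hd i, ← Set.ncard_eq_toFinset_card _ (hfin i), ← Nat.card_coe_set_eq]
    rfl
  rw [hd', hd']
  let G : W → Finset B := fun w => Finset.univ.filter (fun t =>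
    w * cs.simple t ∈ (hfin (i + 1)).toFinset ∧ ¬ cs.length (w * cs.simple t) < cs.length w)
  have hG : ∀ w ∈ (hfin i).toFinset, n - 2 ≤ (G w).card := by
    intro w hw
    rw [Set.Finite.mem_toFinset] at hw
    obtain ⟨hwi, s, hs, hs'⟩ := hw
    have hs'' : ∀ x, NN cs w (cs.simple x) ≠ 0 → x = s :=
      fun x hx => hs' x ((desc_iff cs w x).2 hx)
    have hmem : ∀ t, t ≠ s → t ∉ G w →
        ¬ ∃! x : B, NN cs (w * cs.simple t) (cs.simple x) ≠ 0 := by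
      intro t hts htG hex
      apply htG
      have h1 : ¬ cs.length (w * cs.simple t) < cs.length w := fun h => hts (hs' t h)
      simp only [G, Finset.mem_filter, Finset.mem_univ, true_and, Set.Finite.mem_toFinset,
        Set.mem_ofPred_eq]
      refine ⟨⟨?_, ?_⟩, h1⟩
      · have := cs.length_mul_simple w t
        omega
      · simpa only [desc_iff] using hex
    obtain ⟨t0, ht0⟩ : ∃ t0, ∀ t, t ≠ s → t ≠ t0 → t ∈ G w := by
      by_cases h : ∃ t0, t0 ≠ s ∧ t0 ∉ G w
      · obtain ⟨t0, h0, h0'⟩ := h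
        refine ⟨t0, fun t hts htt => ?_⟩
        by_contra hcon
        exact htt (bad_unique cs hm hM w s hs'' t t0 hts h0 (hmem t hts hcon) (hmem t0 h0 h0'))
      · push Not at h
        exact ⟨s, fun t hts _ => h t hts⟩
    have hsub : Finset.univ \ {s, t0} ⊆ G w := by
      intro t ht
      simp only [Finset.mem_sdiff, Finset.mem_univ, true_and, Finset.mem_insert,
        Finset.mem_singleton, not_or] at ht
      exact ht0 t ht.1 ht.2
    have h1 := Finset.card_le_card hsub
    have h2 := Finset.le_card_sdiff {s, t0} (Finset.univ : Finset B)
    have h3 : ({s, t0} : Finset B).card ≤ 2 := Finset.card_le_two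
    rw [Finset.card_univ, hn] at h2
    omega
  calc (n - 2) * (hfin i).toFinset.card = ∑ _w ∈ (hfin i).toFinset, (n - 2) := by
        rw [Finset.sum_const, smul_eq_mul, mul_comm]
    _ ≤ ∑ w ∈ (hfin i).toFinset, (G w).card := Finset.sum_le_sum hG
    _ = ((hfin i).toFinset.sigma G).card := (Finset.card_sigma _ _).symm
    _ ≤ (hfin (i + 1)).toFinset.card := by
      refine Finset.card_le_card_of_injOn (fun p => p.1 * cs.simple p.2) ?_ ?_
      · rintro ⟨w, t⟩ hp
        simp only [Finset.coe_sigma, Set.mem_sigma_iff, Finset.mem_coe, G, Finset.mem_filter] at hp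
        exact hp.2.2.1
      · rintro ⟨w, t⟩ hp ⟨w', t'⟩ hp' heq
        simp only [Finset.coe_sigma, Set.mem_sigma_iff, Finset.mem_coe, G, Finset.mem_filter] at hp hp'
        simp only at heq
        have hu := hp.2.2.1
        rw [Set.Finite.mem_toFinset] at hu
        have l1 : cs.length (w * cs.simple t * cs.simple t) < cs.length (w * cs.simple t) := by
          rw [cs.simple_mul_simple_cancel_right]
          have := cs.length_mul_simple_ne w t
          have := hp.2.2.2
          omega
        have l2 : cs.length (w * cs.simple t * cs.simple t') < cs.length (w * cs.simple t) := by
          rw [heq, cs.simple_mul_simple_cancel_right]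
          have := cs.length_mul_simple_ne w' t'
          have := hp'.2.2.2
          omega
        obtain rfl := hu.2.unique l1 l2
        have := mul_right_cancel heq
        rw [this]
end
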